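/- arXiv:1101.2951 — 2 statements merged into one kernel-verified Lean document; each statement's English description precedes it below -/
import Mathlib

section
/- For every natural number n, s(9n) − 3·s(n) = 2·A(n) − 4·B(n), where A(n) is the number of triples (x,y,z) ∈ ℤ³ with x² + y² + 3z² + xy = n and B(n) is the number of triples (x,y,z) ∈ ℤ³ with 4x² + 3y² + 4z² + 4zx = n. -/
/-- Number of representations of `n` as a sum of three integer squares. -/
noncomputable def s (n : ℕ) : ℕ :=
  Set.ncard {v : ℤ × ℤ × ℤ | v.1 ^ 2 + v.2.1 ^ 2 + v.2.2 ^ 2 = (n : ℤ)}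

/-- Number of representations of `n` by the ternary form
`a x² + b y² + c z² + d yz + e zx + f xy`. -/
noncomputable def R (a b c d e f : ℤ) (n : ℕ) : ℕ :=
  Set.ncard {v : ℤ × ℤ × ℤ |
    a * v.1 ^ 2 + b * v.2.1 ^ 2 + c * v.2.2 ^ 2 + d * v.2.1 * v.2.2 +
      e * v.2.2 * v.1 + f * v.1 * v.2.1 = (n : ℤ)}

open Filter Topology

/-- The triangular number `k (k - 1) / 2` of an integer `k`. -/
def triangular (k : ℤ) : ℤ := k * (k - 1) / 2

lemma two_mul_triangular (k : ℤ) : 2 * triangular k = k * (k - 1) := by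
  have h : (2 : ℤ) ∣ k * (k - 1) := by
    simpa [mul_comm] using (Int.even_mul_pred_self k).two_dvd
  exact Int.mul_ediv_cancel' h

lemma triangular_add_one (k : ℤ) : triangular (k + 1) = triangular k + k := by
  have h₁ := two_mul_triangular k
  have h₂ := two_mul_triangular (k + 1)
  linarith

lemma triangular_sub_one (k : ℤ) : triangular (k - 1) = triangular k - (k - 1) := by
  have h := triangular_add_one (k - 1)
  rw [sub_add_cancel] at h
  linarith

lemma summable_zpow_triangular_nat {q t : ℂ} (hq : q ≠ 0) (hq' : ‖q‖ < 1) (ht : t ≠ 0) :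
    Summable fun n : ℕ => q ^ triangular n * t ^ (n : ℤ) := by
  refine summable_of_ratio_test_tendsto_lt_one (l := 0) one_pos
    (.of_forall fun n => mul_ne_zero (zpow_ne_zero _ hq) (zpow_ne_zero _ ht)) ?_
  have h : Tendsto (fun n : ℕ => ‖q‖ ^ n * ‖t‖) atTop (𝓝 (0 * ‖t‖)) :=
    (tendsto_pow_atTop_nhds_zero_of_lt_one (norm_nonneg q) hq').mul_const _
  rw [zero_mul] at h
  refine h.congr fun n => ?_
  have hq₀ : ‖q‖ ≠ 0 := norm_ne_zero_iff.2 hq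
  have ht₀ : ‖t‖ ≠ 0 := norm_ne_zero_iff.2 ht
  push_cast
  rw [triangular_add_one, zpow_add₀ hq, zpow_add₀ ht]
  simp only [norm_mul, norm_zpow, norm_pow, zpow_natCast, zpow_one]
  field_simp

lemma summable_zpow_triangular {q t : ℂ} (hq : q ≠ 0) (hq' : ‖q‖ < 1) (ht : t ≠ 0) :
    Summable fun k : ℤ => q ^ triangular k * t ^ k := by
  refine .of_nat_of_neg (summable_zpow_triangular_nat hq hq' ht) ?_
  have h := summable_zpow_triangular_nat hq hq' (t := q * t⁻¹) (by simp [hq, ht])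
  refine h.congr fun n => ?_
  have : triangular (-n) = triangular n + n := by
    have h₁ := two_mul_triangular n
    have h₂ := two_mul_triangular (-n)
    linarith
  rw [this, zpow_add₀ hq, mul_zpow, inv_zpow', mul_assoc]

/-- The infinite `q`-product `∏ (1 + t q ^ i)`, over `i ≥ 0`. -/
noncomputable def qProd (t q : ℂ) : ℂ := ∏' i : ℕ, (1 + t * q ^ i)

lemma summable_norm_mul_pow (t : ℂ) {q : ℂ} (hq : ‖q‖ < 1) :
    Summable fun i : ℕ => ‖t * q ^ i‖ := by
  simpa only [norm_mul, norm_pow] using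
    (summable_geometric_of_lt_one (norm_nonneg q) hq).mul_left ‖t‖

lemma multipliable_qProd (t : ℂ) {q : ℂ} (hq : ‖q‖ < 1) :
    Multipliable fun i : ℕ => 1 + t * q ^ i :=
  multipliable_one_add_of_summable (summable_norm_mul_pow t hq)

lemma tendsto_qProd (t : ℂ) {q : ℂ} (hq : ‖q‖ < 1) :
    Tendsto (fun n => ∏ i ∈ Finset.range n, (1 + t * q ^ i)) atTop (𝓝 (qProd t q)) :=
  (multipliable_qProd t hq).tendsto_prod_tprod_nat

lemma one_add_mul_pow_ne_zero {t q : ℂ} (hq : ‖q‖ < 1) (ht : ‖t‖ < 1) (i : ℕ) :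
    1 + t * q ^ i ≠ 0 := by
  intro h
  have h₁ : ‖t * q ^ i‖ < 1 := by
    rw [norm_mul, norm_pow]
    exact mul_lt_one_of_nonneg_of_lt_one_left (norm_nonneg _) ht
      (pow_le_one₀ (norm_nonneg _) hq.le)
  rw [show t * q ^ i = -1 by linear_combination h] at h₁
  simp at h₁

lemma qProd_ne_zero {t q : ℂ} (hq : ‖q‖ < 1) (ht : ‖t‖ < 1) : qProd t q ≠ 0 :=
  tprod_one_add_ne_zero_of_summable (one_add_mul_pow_ne_zero hq ht)
    (summable_norm_mul_pow t hq)

/-- The reciprocal of the `q`-Pochhammer symbol `(q; q)_m`, extended by zero to `m < 0`. -/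
noncomputable def invPoch (q : ℂ) (m : ℤ) : ℂ :=
  if m < 0 then 0 else (∏ i ∈ Finset.range m.toNat, (1 + -q * q ^ i))⁻¹

lemma invPoch_sub_one {q : ℂ} (hq : ‖q‖ < 1) (m : ℤ) :
    invPoch q (m - 1) = (1 - q ^ m) * invPoch q m := by
  rcases lt_trichotomy m 0 with h | rfl | h
  · simp [invPoch, h, show m - 1 < 0 by lia]
  · simp [invPoch]
  · obtain ⟨n, rfl⟩ : ∃ n : ℕ, m = n + 1 := ⟨(m - 1).toNat, by lia⟩
    have hn := one_add_mul_pow_ne_zero hq (t := -q) (by simpa using hq) n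
    rw [add_sub_cancel_right, invPoch, invPoch, if_neg (by lia), if_neg (by lia)]
    rw [show ((n : ℤ) + 1).toNat = n + 1 by lia, Int.toNat_natCast, Finset.prod_range_succ,
      show (1 : ℂ) - q ^ ((n : ℤ) + 1) = 1 + -q * q ^ n by
        rw [show ((n : ℤ) + 1) = ((n + 1 : ℕ) : ℤ) by simp, zpow_natCast]; ring]
    rw [mul_inv_rev, mul_inv_cancel_left₀ hn]

/-- The finite form of the Jacobi triple product identity. -/
lemma hasSum_finite_jacobi_triple {q t : ℂ} (hq : q ≠ 0) (hq' : ‖q‖ < 1) (ht : t ≠ 0) (n : ℕ) :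
    HasSum (fun k : ℤ => (∏ i ∈ Finset.range (2 * n), (1 + -q * q ^ i)) *
      (invPoch q (n + k) * invPoch q (n - k)) * (q ^ triangular k * t ^ k))
      ((∏ i ∈ Finset.range n, (1 + t * q ^ i)) *
        ∏ i ∈ Finset.range n, (1 + q / t * q ^ i)) := by
  induction n with
  | zero =>
    convert hasSum_single (0 : ℤ) ?_ using 1
    · simp [invPoch, triangular]
    · intro k hk
      rcases lt_or_gt_of_ne hk with h | h <;> simp [invPoch, h]
  | succ n ih =>
    have h₁ := ((Equiv.subRight (1 : ℤ)).hasSum_iff.2 ih).mul_left (t * q ^ n)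
    have h₂ := ((Equiv.addRight (1 : ℤ)).hasSum_iff.2 ih).mul_left (q / t * q ^ n)
    have h₃ := ((ih.mul_left (1 + q ^ (2 * n + 1))).add h₁).add h₂
    have hmul : ∀ x y : ℂ, x * (1 + t * q ^ n) * (y * (1 + q / t * q ^ n)) =
        (1 + q ^ (2 * n + 1)) * (x * y) + t * q ^ n * (x * y) + q / t * q ^ n * (x * y) := by
      intro x y
      field_simp
      ring
    rw [Finset.prod_range_succ, Finset.prod_range_succ, hmul]
    refine (congrArg (HasSum · _) (funext fun k => ?_)).mpr h₃
    have ha : q ^ ((n : ℤ) + 1 + k) = q ^ n * q * q ^ k := by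
      rw [zpow_add₀ hq, zpow_add₀ hq]; simp
    have hb : q ^ ((n : ℤ) + 1 - k) = q ^ n * q / q ^ k := by
      rw [zpow_sub₀ hq, zpow_add₀ hq]; simp
    have hqk : q ^ k ≠ 0 := zpow_ne_zero _ hq
    have htk : t ^ k ≠ 0 := zpow_ne_zero _ ht
    have e₁ := invPoch_sub_one hq' ((n : ℤ) + 1 + k)
    have e₂ := invPoch_sub_one hq' ((n : ℤ) + 1 + k - 1)
    have f₁ := invPoch_sub_one hq' ((n : ℤ) + 1 - k)
    have f₂ := invPoch_sub_one hq' ((n : ℤ) + 1 - k - 1)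
    rw [zpow_sub_one₀ hq] at e₂ f₂
    rw [e₁] at e₂
    rw [f₁] at f₂
    rw [ha] at e₁ e₂
    rw [hb] at f₁ f₂
    simp only [Function.comp, Equiv.subRight_apply, Equiv.coe_addRight]
    rw [triangular_sub_one, triangular_add_one, zpow_sub₀ hq, zpow_sub_one₀ hq, zpow_add₀ hq,
      zpow_sub_one₀ ht, zpow_add_one₀ ht,
      show (n : ℤ) + k = n + 1 + k - 1 by ring, show (n : ℤ) - k = n + 1 - k - 1 by ring,
      show (n : ℤ) + (k - 1) = n + 1 + k - 1 - 1 by ring,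
      show (n : ℤ) - (k - 1) = n + 1 - k by ring,
      show (n : ℤ) + (k + 1) = n + 1 + k by ring,
      show (n : ℤ) - (k + 1) = n + 1 - k - 1 - 1 by ring, e₂, f₂, e₁, f₁]
    push_cast
    rw [show 2 * (n + 1) = 2 * n + 1 + 1 by ring, Finset.prod_range_succ,
      Finset.prod_range_succ]
    field_simp
    ring

/-- The Jacobi triple product identity. -/
theorem jacobi_triple_product {q t : ℂ} (hq : q ≠ 0) (hq' : ‖q‖ < 1) (ht : t ≠ 0) :
    ∑' k : ℤ, q ^ triangular k * t ^ k = qProd (-q) q * qProd t q * qProd (q / t) q := by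
  have hE := qProd_ne_zero hq' (t := -q) (by simpa using hq')
  have hlim := tendsto_qProd (-q) hq'
  have hinv : Tendsto (fun m : ℕ => invPoch q m) atTop (𝓝 (qProd (-q) q)⁻¹) := by
    simpa only [invPoch, Int.natCast_nonneg, not_lt.2, if_false, Int.toNat_natCast] using
      hlim.inv₀ hE
  obtain ⟨C, hC⟩ := (Metric.isBounded_range_of_tendsto _ hlim).exists_norm_le
  obtain ⟨K, hK⟩ := (Metric.isBounded_range_of_tendsto _ hinv).exists_norm_le
  have hC' : ∀ n, ‖∏ i ∈ Finset.range n, (1 + -q * q ^ i)‖ ≤ C := fun n => hC _ ⟨n, rfl⟩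
  have hC₀ : 0 ≤ C := (norm_nonneg _).trans (hC' 0)
  have hK₀ : 0 ≤ K := (norm_nonneg _).trans (hK _ ⟨0, rfl⟩)
  have hK' : ∀ m : ℤ, ‖invPoch q m‖ ≤ K := by
    intro m
    rcases lt_or_ge m 0 with h | h
    · simpa [invPoch, h] using hK₀
    · lift m to ℕ using h
      exact hK _ ⟨m, rfl⟩
  have key : Tendsto (fun n : ℕ => ∑' k : ℤ, (∏ i ∈ Finset.range (2 * n), (1 + -q * q ^ i)) *
      (invPoch q (n + k) * invPoch q (n - k)) * (q ^ triangular k * t ^ k)) atTop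
      (𝓝 (∑' k : ℤ, qProd (-q) q * ((qProd (-q) q)⁻¹ * (qProd (-q) q)⁻¹) *
        (q ^ triangular k * t ^ k))) := by
    refine tendsto_tsum_of_dominated_convergence
      (bound := fun k => C * (K * K) * ‖q ^ triangular k * t ^ k‖)
      ((summable_zpow_triangular hq hq' ht).norm.mul_left _) (fun k => ?_)
      (.of_forall fun n k => ?_)
    · have hnat : Tendsto (fun n : ℕ => 2 * n) atTop atTop :=
        tendsto_id.const_mul_atTop' two_pos
      have hadd : ∀ j : ℤ, Tendsto (fun n : ℕ => invPoch q (n + j)) atTop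
          (𝓝 (qProd (-q) q)⁻¹) := fun j => by
        have : Tendsto (fun n : ℕ => ((n : ℤ) + j).toNat) atTop atTop :=
          tendsto_atTop.2 fun b => (eventually_ge_atTop (b + j.natAbs)).mono fun n hn => by lia
        refine (hinv.comp this).congr' ?_
        filter_upwards [eventually_ge_atTop j.natAbs] with n hn
        simp only [Function.comp]
        rw [Int.toNat_of_nonneg (by lia)]
      exact ((hlim.comp hnat).mul ((hadd k).mul
        (by simpa [sub_eq_add_neg] using hadd (-k)))).mul_const _
    · rw [norm_mul, norm_mul, norm_mul]
      gcongr
      exacts [hC' _, hK' _, hK' _]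
  have hfin : Tendsto (fun n : ℕ => (∏ i ∈ Finset.range n, (1 + t * q ^ i)) *
      ∏ i ∈ Finset.range n, (1 + q / t * q ^ i)) atTop (𝓝 (qProd t q * qProd (q / t) q)) :=
    (tendsto_qProd t hq').mul (tendsto_qProd (q / t) hq')
  have := tendsto_nhds_unique (key.congr fun n =>
    (hasSum_finite_jacobi_triple hq hq' ht n).tsum_eq) hfin
  rw [tsum_mul_left, mul_inv_cancel_left₀ hE] at this
  rw [mul_assoc, ← this, mul_inv_cancel_left₀ hE]

/-- The theta series `∑ q ^ (k (k - 1) / 2) t ^ k`, over all integers `k`. -/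
noncomputable def thetaSeries (q t : ℂ) : ℂ := ∑' k : ℤ, q ^ triangular k * t ^ k

lemma qProd_eq_one_add_mul (t : ℂ) {q : ℂ} (hq : ‖q‖ < 1) :
    qProd t q = (1 + t) * qProd (t * q) q := by
  have h : (fun i : ℕ => 1 + t * q * q ^ i) = fun i => 1 + t * q ^ (i + 1) := by
    funext i; ring
  have hm := multipliable_qProd (t * q) hq
  rw [h] at hm
  have h₀ := tprod_eq_zero_mul' (f := fun i : ℕ => 1 + t * q ^ i) hm
  rw [pow_zero, mul_one, ← h] at h₀
  exact h₀

lemma qProd_mul_qProd_neg (t : ℂ) {q : ℂ} (hq : ‖q‖ < 1) :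
    qProd (-t) q * qProd t q = qProd (-t ^ 2) (q ^ 2) := by
  rw [qProd, qProd, ← (multipliable_qProd _ hq).tprod_mul (multipliable_qProd _ hq), qProd]
  exact tprod_congr fun i => by ring

lemma qProd_sq_mul_qProd_sq (t : ℂ) {q : ℂ} (hq : ‖q‖ < 1) :
    qProd t (q ^ 2) * qProd (t * q) (q ^ 2) = qProd t q := by
  have hq₂ : ‖q ^ 2‖ < 1 := by
    rw [norm_pow]; exact pow_lt_one₀ (norm_nonneg _) hq two_ne_zero
  have he : ∀ i : ℕ, 1 + t * (q ^ 2) ^ i = 1 + t * q ^ (2 * i) := fun i => by ring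
  have ho : ∀ i : ℕ, 1 + t * q * (q ^ 2) ^ i = 1 + t * q ^ (2 * i + 1) := fun i => by ring
  have h₁ := multipliable_qProd t hq₂
  have h₂ := multipliable_qProd (t * q) hq₂
  simp only [he] at h₁
  simp only [ho] at h₂
  simp only [qProd, he, ho]
  exact tprod_even_mul_odd (f := fun i => 1 + t * q ^ i) h₁ h₂

lemma qProd_cube_roots (t : ℂ) {q ω : ℂ} (hq : ‖q‖ < 1) (hω : ω ^ 2 + ω + 1 = 0) :
    qProd t q * (qProd (ω * t) q * qProd (ω ^ 2 * t) q) = qProd (t ^ 3) (q ^ 3) := by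
  have h := fun s => multipliable_qProd s hq
  rw [qProd, qProd, qProd, ← (h _).tprod_mul (h _), ← (h _).tprod_mul ((h _).mul (h _)), qProd]
  refine tprod_congr fun i => ?_
  rw [← pow_mul, mul_comm 3 i, pow_mul]
  linear_combination ((t * q ^ i) + (t * q ^ i) ^ 2 * ω + (t * q ^ i) ^ 3 * (ω - 1)) * hω

/-- Euler's identity `∏ (1 - r ^ (2 i + 1)) ∏ (1 + r ^ (i + 1)) = 1`. -/
lemma qProd_euler {r : ℂ} (hr : ‖r‖ < 1) : qProd (-r) (r ^ 2) * qProd r r = 1 := by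
  have hE : qProd (-r) r ≠ 0 := qProd_ne_zero hr (by simpa using hr)
  have h₁ := qProd_sq_mul_qProd_sq (-r) hr
  have h₂ := qProd_mul_qProd_neg r hr
  rw [show -r * r = -r ^ 2 by ring, ← h₂] at h₁
  refine mul_left_cancel₀ hE ?_
  linear_combination h₁

section evaluations

variable {r : ℂ}

lemma thetaSeries_one (hr₀ : r ≠ 0) (hr : ‖r‖ < 1) :
    thetaSeries r 1 = 2 * qProd (-r) r * qProd r r ^ 2 := by
  rw [thetaSeries, jacobi_triple_product hr₀ hr one_ne_zero, qProd_eq_one_add_mul 1 hr,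
    one_mul, div_one]
  ring

lemma thetaSeries_cube_root {ω : ℂ} (hr₀ : r ≠ 0) (hr : ‖r‖ < 1) (hω : ω ^ 2 + ω + 1 = 0) :
    thetaSeries r ω * qProd r r = (1 + ω) * qProd (-r) r * qProd (r ^ 3) (r ^ 3) := by
  have hω₃ : ω ^ 3 = 1 := by linear_combination (ω - 1) * hω
  have hω₀ : ω ≠ 0 := by rintro rfl; simp at hω₃
  have h : r / ω = ω ^ 2 * r := by
    rw [div_eq_iff hω₀]; linear_combination -r * hω₃
  rw [thetaSeries, jacobi_triple_product hr₀ hr hω₀, qProd_eq_one_add_mul ω hr, h,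
    ← qProd_cube_roots r hr hω]
  ring

lemma thetaSeries_sq_neg (hr₀ : r ≠ 0) (hr : ‖r‖ < 1) :
    thetaSeries (r ^ 2) (-r) * qProd r r = qProd (-r) r := by
  have hr₂ : ‖r ^ 2‖ < 1 := by
    rw [norm_pow]; exact pow_lt_one₀ (norm_nonneg _) hr two_ne_zero
  have h : r ^ 2 / -r = -r := by field_simp
  have hE := qProd_euler hr
  rw [thetaSeries, jacobi_triple_product (pow_ne_zero 2 hr₀) hr₂ (neg_ne_zero.2 hr₀), h,
    ← qProd_mul_qProd_neg r hr]
  linear_combination qProd (-r) r * (qProd (-r) (r ^ 2) * qProd r r + 1) * hE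

lemma thetaSeries_sq_cube_root {ω : ℂ} (hr₀ : r ≠ 0) (hr : ‖r‖ < 1)
    (hω : ω ^ 2 + ω + 1 = 0) :
    thetaSeries (r ^ 2) (ω * -r) * qProd (r ^ 3) (r ^ 3) = qProd (-r) r * qProd r r ^ 2 := by
  have hr₂ : ‖r ^ 2‖ < 1 := by
    rw [norm_pow]; exact pow_lt_one₀ (norm_nonneg _) hr two_ne_zero
  have hr₃ : ‖r ^ 3‖ < 1 := by
    rw [norm_pow]; exact pow_lt_one₀ (norm_nonneg _) hr three_ne_zero
  have hω₃ : ω ^ 3 = 1 := by linear_combination (ω - 1) * hω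
  have hω₀ : ω ≠ 0 := by rintro rfl; simp at hω₃
  have h : r ^ 2 / (ω * -r) = ω ^ 2 * -r := by
    rw [div_eq_iff (by simp [hω₀, hr₀])]; linear_combination -r ^ 2 * hω₃
  have hA := qProd_euler hr
  have hA₃ := qProd_euler hr₃
  have hc := qProd_cube_roots (-r) hr₂ hω
  rw [show (-r) ^ 3 = -r ^ 3 by ring, show (r ^ 2) ^ 3 = (r ^ 3) ^ 2 by ring] at hc
  rw [thetaSeries, jacobi_triple_product (pow_ne_zero 2 hr₀) hr₂ (by simp [hω₀, hr₀]), h,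
    ← qProd_mul_qProd_neg r hr]
  rw [← hc] at hA₃
  linear_combination qProd (-r) r * qProd r r ^ 2 * hA₃ - qProd (-r) r * qProd r r *
    qProd (ω * -r) (r ^ 2) * qProd (ω ^ 2 * -r) (r ^ 2) * qProd (r ^ 3) (r ^ 3) * hA

end evaluations

lemma HasSum.mul_of_summable_norm {ι κ : Type*} {c : ι → ℂ} {d : κ → ℂ} {a b : ℂ}
    (hc : HasSum c a) (hd : HasSum d b) :
    HasSum (fun p : ι × κ => c p.1 * d p.2) (a * b) :=
  hc.mul hd (summable_mul_of_summable_norm hc.summable.norm hd.summable.norm)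

lemma HasSum.cube {c : ℤ → ℂ} {a : ℂ} (hc : HasSum c a) :
    HasSum (fun p : ℤ × ℤ × ℤ => c p.1 * (c p.2.1 * c p.2.2)) (a ^ 3) := by
  obtain ⟨d, hd⟩ : ∃ d : ℤ × ℤ → ℂ, ∀ p, d p = c p.1 * c p.2 := ⟨_, fun _ => rfl⟩
  have h : HasSum d (a * a) := by
    rw [funext hd]
    exact hc.mul_of_summable_norm hc
  have h₃ := hc.mul_of_summable_norm h
  rw [show a * (a * a) = a ^ 3 by ring] at h₃
  refine h₃.congr_fun fun p => ?_
  rw [hd]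

/-- The hexagonal form `u² + uv + v²`. -/
def hexForm (p : ℤ × ℤ) : ℤ := p.1 ^ 2 + p.1 * p.2 + p.2 ^ 2

/-- The coordinates on the sublattice of `ℤ³` of vectors whose entries sum to a multiple of `3`. -/
def sumZeroMod (p : ℤ × ℤ × ℤ) : ℤ × ℤ × ℤ :=
  (p.1 + p.2.1, p.1 + p.2.2, p.1 - p.2.1 - p.2.2)

lemma sumZeroMod_injective : Function.Injective sumZeroMod := by
  rintro ⟨z, u, v⟩ ⟨z', u', v'⟩ h
  simp only [sumZeroMod, Prod.mk.injEq] at h ⊢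
  lia

lemma mem_range_sumZeroMod {p : ℤ × ℤ × ℤ} :
    p ∈ Set.range sumZeroMod ↔ 3 ∣ p.1 + p.2.1 + p.2.2 := by
  constructor
  · rintro ⟨⟨z, u, v⟩, rfl⟩
    exact ⟨z, by simp only [sumZeroMod]; ring⟩
  · rintro ⟨z, hz⟩
    refine ⟨(z, p.1 - z, p.2.1 - z), ?_⟩
    ext <;> simp only [sumZeroMod] <;> lia

lemma triangular_sumZeroMod (z u v : ℤ) :
    triangular (z + u) + (triangular (z + v) + triangular (z - u - v)) =
      3 * triangular z + hexForm (u, v) := by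
  have h₁ := two_mul_triangular (z + u)
  have h₂ := two_mul_triangular (z + v)
  have h₃ := two_mul_triangular (z - u - v)
  have h₄ := two_mul_triangular z
  simp only [hexForm]
  linarith

section cubes

variable {q t ω : ℂ}

lemma one_add_zpow_cube_root (hω : ω ^ 2 + ω + 1 = 0) (m : ℤ) :
    1 + ω ^ m + (ω ^ 2) ^ m = if 3 ∣ m then 3 else 0 := by
  have hω₃ : ω ^ (3 : ℤ) = 1 := by
    norm_cast; linear_combination (ω - 1) * hω
  have hω₀ : ω ≠ 0 := by rintro rfl; simp at hω
  have h₂ : (ω ^ 2) ^ m = (ω ^ m) ^ 2 := by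
    rw [← zpow_natCast, ← zpow_natCast, ← zpow_mul, ← zpow_mul, mul_comm]
  have hm : ω ^ m = ω ^ (m % 3) := by
    conv_lhs => rw [← Int.mul_ediv_add_emod m 3, zpow_add₀ hω₀, zpow_mul, hω₃, one_zpow, one_mul]
  rw [h₂, hm]
  obtain h | h | h : m % 3 = 0 ∨ m % 3 = 1 ∨ m % 3 = 2 := by lia
  · rw [if_pos (by lia), h]; norm_num
  · rw [if_neg (by lia), h, zpow_one]; linear_combination hω
  · rw [if_neg (by lia), h]
    norm_cast
    linear_combination (ω ^ 2 - ω + 1) * hω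

lemma hasSum_thetaSeries_cubes (hq : q ≠ 0) (hq' : ‖q‖ < 1) (ht : t ≠ 0)
    (hω : ω ^ 2 + ω + 1 = 0) :
    HasSum (fun p : ℤ × ℤ × ℤ =>
        3 * (((q ^ 3) ^ triangular p.1 * (t ^ 3) ^ p.1) * q ^ hexForm p.2))
      (thetaSeries q t ^ 3 + thetaSeries q (ω * t) ^ 3 + thetaSeries q (ω ^ 2 * t) ^ 3) := by
  have hω₀ : ω ≠ 0 := by rintro rfl; simp at hω
  have key : ∀ {s : ℂ}, s ≠ 0 → HasSum (fun k : ℤ => q ^ triangular k * s ^ k)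
      (thetaSeries q s) := fun hs => (summable_zpow_triangular hq hq' hs).hasSum
  have h₁ := (key ht).cube
  have h₂ := (key (mul_ne_zero hω₀ ht)).cube
  have h₃ := (key (mul_ne_zero (pow_ne_zero 2 hω₀) ht)).cube
  have h := (h₁.add h₂).add h₃
  rw [← sumZeroMod_injective.hasSum_iff] at h
  · convert h using 2 with p
    obtain ⟨z, u, v⟩ := p
    have hT : q ^ triangular (z + u) * (q ^ triangular (z + v) * q ^ triangular (z - u - v)) =
        (q ^ 3) ^ triangular z * q ^ hexForm (u, v) := by
      rw [← zpow_natCast q 3, ← zpow_mul, ← zpow_add₀ hq, ← zpow_add₀ hq, ← zpow_add₀ hq,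
        triangular_sumZeroMod]
      rfl
    have hs : ∀ {s : ℂ}, s ≠ 0 → s ^ (z + u) * (s ^ (z + v) * s ^ (z - u - v)) =
        (s ^ 3) ^ z := fun {s} hs => by
      rw [← zpow_natCast s 3, ← zpow_mul, ← zpow_add₀ hs, ← zpow_add₀ hs]
      congr 1
      push_cast
      ring
    have e₁ := hs ht
    have e₂ := hs (mul_ne_zero hω₀ ht)
    have e₃ := hs (mul_ne_zero (pow_ne_zero 2 hω₀) ht)
    have hω₃ : ω ^ 3 = 1 := by linear_combination (ω - 1) * hω
    rw [show (ω * t) ^ 3 = t ^ 3 by linear_combination t ^ 3 * hω₃] at e₂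
    rw [show (ω ^ 2 * t) ^ 3 = t ^ 3 by linear_combination t ^ 3 * (ω ^ 3 + 1) * hω₃] at e₃
    simp only [Function.comp, sumZeroMod]
    calc _ = ((q ^ 3) ^ triangular z * q ^ hexForm (u, v)) *
          ((t ^ 3) ^ z + (t ^ 3) ^ z + (t ^ 3) ^ z) := by ring
      _ = _ := by rw [← hT]; nth_rw 1 [← e₁]; nth_rw 1 [← e₂]; rw [← e₃]; ring
  · rintro ⟨i, j, k⟩ hp
    rw [mem_range_sumZeroMod] at hp
    have h := one_add_zpow_cube_root hω (i + j + k)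
    rw [if_neg hp, zpow_add₀ hω₀, zpow_add₀ hω₀, zpow_add₀ (pow_ne_zero 2 hω₀),
      zpow_add₀ (pow_ne_zero 2 hω₀)] at h
    simp only [mul_zpow]
    linear_combination q ^ triangular i * t ^ i * (q ^ triangular j * t ^ j) *
      (q ^ triangular k * t ^ k) * h

lemma exists_cube_root : ∃ ω : ℂ, ω ^ 2 + ω + 1 = 0 := by
  obtain ⟨s, hs⟩ := IsAlgClosed.exists_pow_nat_eq (-3 : ℂ) two_pos
  exact ⟨(-1 + s) / 2, by linear_combination hs / 4⟩

lemma summable_hexForm (hq : q ≠ 0) (hq' : ‖q‖ < 1) : Summable fun p => q ^ hexForm p := by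
  obtain ⟨ω, hω⟩ := exists_cube_root
  have h := (hasSum_thetaSeries_cubes hq hq' one_ne_zero hω).summable.comp_injective
    (i := fun p : ℤ × ℤ => ((0 : ℤ), p)) (Prod.mk_right_injective 0)
  refine (h.mul_left (1 / 3)).congr fun p => ?_
  simp [triangular]

/-- The theta series of the hexagonal lattice. -/
noncomputable def hexTheta (q : ℂ) : ℂ := ∑' p, q ^ hexForm p

lemma thetaSeries_cubes (hq : q ≠ 0) (hq' : ‖q‖ < 1) (ht : t ≠ 0)
    (hω : ω ^ 2 + ω + 1 = 0) :
    thetaSeries q t ^ 3 + thetaSeries q (ω * t) ^ 3 + thetaSeries q (ω ^ 2 * t) ^ 3 =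
      3 * (thetaSeries (q ^ 3) (t ^ 3) * hexTheta q) := by
  have hq₃ : ‖q ^ 3‖ < 1 := by
    rw [norm_pow]; exact pow_lt_one₀ (norm_nonneg _) hq' three_ne_zero
  have h₁ := summable_zpow_triangular (pow_ne_zero 3 hq) hq₃ (pow_ne_zero 3 ht)
  have h₂ := summable_hexForm hq hq'
  rw [← (hasSum_thetaSeries_cubes hq hq' ht hω).tsum_eq, tsum_mul_left, thetaSeries, hexTheta,
    tsum_mul_tsum_of_summable_norm h₁.norm h₂.norm]

end cubes

theorem thetaSeries_cube_eq {r : ℂ} (hr₀ : r ≠ 0) (hr : ‖r‖ < 1) :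
    thetaSeries (r ^ 2) (-r) ^ 3 =
      thetaSeries (r ^ 6) (-r ^ 3) * (2 * hexTheta (r ^ 2) - hexTheta r) := by
  obtain ⟨ω, hω⟩ := exists_cube_root
  have hω' : (ω ^ 2) ^ 2 + ω ^ 2 + 1 = 0 := by linear_combination (ω ^ 2 - ω + 1) * hω
  have hω₃ : ω ^ 3 = 1 := by linear_combination (ω - 1) * hω
  have hr₂ : ‖r ^ 2‖ < 1 := by
    rw [norm_pow]; exact pow_lt_one₀ (norm_nonneg _) hr two_ne_zero
  have hr₃ : ‖r ^ 3‖ < 1 := by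
    rw [norm_pow]; exact pow_lt_one₀ (norm_nonneg _) hr three_ne_zero
  have hr₃' := pow_ne_zero 3 hr₀
  have a₁ := thetaSeries_cubes (pow_ne_zero 2 hr₀) hr₂ (neg_ne_zero.2 hr₀) hω
  have a₂ := thetaSeries_cubes hr₀ hr one_ne_zero hω
  have hφ := thetaSeries_sq_neg hr₀ hr
  have hφ₃ := thetaSeries_sq_neg hr₃' hr₃
  have hY := thetaSeries_sq_cube_root hr₀ hr hω
  have hY' := thetaSeries_sq_cube_root hr₀ hr hω'
  have hψ := thetaSeries_one hr₀ hr
  have hψ₃ := thetaSeries_one hr₃' hr₃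
  have hX := thetaSeries_cube_root hr₀ hr hω
  have hX' := thetaSeries_cube_root hr₀ hr hω'
  have hB := qProd_ne_zero hr hr
  have hB₃ := qProd_ne_zero hr₃ hr₃
  have hE₃ : qProd (-r ^ 3) (r ^ 3) ≠ 0 := qProd_ne_zero hr₃ (by simpa using hr₃)
  rw [show (r ^ 2) ^ 3 = r ^ 6 by ring, show (-r) ^ 3 = -r ^ 3 by ring] at a₁
  rw [one_pow, mul_one, mul_one] at a₂
  rw [show (r ^ 3) ^ 2 = r ^ 6 by ring] at hφ₃
  generalize qProd r r = B at *
  generalize qProd (r ^ 3) (r ^ 3) = B₃ at *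
  generalize qProd (-r) r = E at *
  generalize qProd (-r ^ 3) (r ^ 3) = E₃ at *
  rw [← eq_div_iff hB] at hφ hX hX'
  rw [← eq_div_iff hB₃] at hφ₃ hY hY'
  rw [hφ, hφ₃, hY, hY'] at a₁
  rw [hψ, hψ₃, hX, hX'] at a₂
  rw [hφ, hφ₃]
  generalize hexTheta (r ^ 2) = x at *
  generalize hexTheta r = y at *
  have hcube : (1 + ω) ^ 3 + (1 + ω ^ 2) ^ 3 = -2 := by
    linear_combination (ω ^ 4 - ω ^ 3 + 3 * ω ^ 2 - ω + 4) * hω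
  field_simp at a₁ a₂ ⊢
  refine mul_left_cancel₀ (mul_ne_zero three_ne_zero (pow_ne_zero 2 hB₃)) ?_
  linear_combination 2 * a₁ - a₂ / 2 + E ^ 3 * B₃ ^ 3 / 2 * hcube

section generatingFunctions

variable {x : ℂ}

lemma hasSum_hexForm (hx₀ : x ≠ 0) (hx : ‖x‖ < 1) :
    HasSum (fun p => x ^ hexForm p) (hexTheta x) :=
  (summable_hexForm hx₀ hx).hasSum

lemma hasSum_sq (hx₀ : x ≠ 0) (hx : ‖x‖ < 1) :
    HasSum (fun k : ℤ => x ^ k ^ 2) (thetaSeries (x ^ 2) x) := by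
  have hx₂ : ‖x ^ 2‖ < 1 := by
    rw [norm_pow]; exact pow_lt_one₀ (norm_nonneg _) hx two_ne_zero
  refine (summable_zpow_triangular (pow_ne_zero 2 hx₀) hx₂ hx₀).hasSum.congr_fun fun k => ?_
  rw [← zpow_natCast, ← zpow_mul, ← zpow_add₀ hx₀]
  congr 1
  have := two_mul_triangular k
  push_cast
  linarith

lemma even_hexForm_iff {p : ℤ × ℤ} : Even (hexForm p) ↔ Even p.1 ∧ Even p.2 := by
  simp only [hexForm]
  grind [Int.even_add, Int.even_pow]

lemma hexTheta_neg (hx₀ : x ≠ 0) (hx : ‖x‖ < 1) :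
    hexTheta (-x) = 2 * hexTheta (x ^ 4) - hexTheta x := by
  have hx₄ : ‖x ^ 4‖ < 1 := by
    rw [norm_pow]; exact pow_lt_one₀ (norm_nonneg _) hx four_ne_zero
  have h := (hasSum_hexForm hx₀ hx).add
    (hasSum_hexForm (neg_ne_zero.2 hx₀) (by rwa [norm_neg]))
  have hinj : Function.Injective fun p : ℤ × ℤ => (2 * p.1, 2 * p.2) := by
    rintro ⟨u, v⟩ ⟨u', v'⟩ h
    simp only [Prod.mk.injEq] at h ⊢
    lia
  rw [← hinj.hasSum_iff] at h
  · refine eq_sub_of_add_eq' (h.unique ?_)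
    refine ((hasSum_hexForm (pow_ne_zero 4 hx₀) hx₄).mul_left 2).congr_fun fun p => ?_
    have he : Even (hexForm (2 * p.1, 2 * p.2)) := by simp [even_hexForm_iff]
    rw [Function.comp_apply, he.neg_zpow, ← two_mul, ← zpow_natCast, ← zpow_mul]
    congr 2
    simp only [hexForm]
    push_cast
    ring
  · intro p hp
    have ho : Odd (hexForm p) := by
      rw [← Int.not_even_iff_odd, even_hexForm_iff]
      rintro ⟨⟨u, hu⟩, ⟨v, hv⟩⟩
      exact hp ⟨(u, v), by ext <;> simp only <;> lia⟩
    rw [ho.neg_zpow, add_neg_cancel]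

lemma hasSum_ncard_fiber {ι : Type*} {f : ι → ℤ} {a : ℂ} (hf : ∀ i, 0 ≤ f i)
    (h : HasSum (fun i => x ^ f i) a) :
    HasSum (fun n : ℕ => x ^ n * (Set.ncard {i | f i = n} : ℂ)) a := by
  refine (h.tsum_fiberwise fun i => (f i).toNat).congr_fun fun n => ?_
  have hs : {i | f i = n} = (fun i => (f i).toNat) ⁻¹' {n} := by
    ext i
    have := hf i
    simp only [Set.mem_ofPred_eq, Set.mem_preimage, Set.mem_singleton_iff]
    lia
  have hc : ∀ i : (fun i => (f i).toNat) ⁻¹' {n}, x ^ f i = x ^ n := by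
    rintro ⟨i, hi⟩
    rw [← hs, Set.mem_ofPred_eq] at hi
    rw [← zpow_natCast, ← hi]
  rw [tsum_congr hc, tsum_const, hs, nsmul_eq_mul, mul_comm]
  rfl

lemma hasSum_theta_mul_hexTheta (hx₀ : x ≠ 0) (hx : ‖x‖ < 1) {m : ℕ} (hm : m ≠ 0) :
    HasSum (fun n : ℕ => x ^ n *
        (Set.ncard {p : ℤ × ℤ × ℤ | 3 * p.1 ^ 2 + m * hexForm p.2 = n} : ℂ))
      (thetaSeries (x ^ 6) (x ^ 3) * hexTheta (x ^ m)) := by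
  have hpow : ∀ {k : ℕ}, k ≠ 0 → ‖x ^ k‖ < 1 := fun hk => by
    rw [norm_pow]; exact pow_lt_one₀ (norm_nonneg _) hx hk
  have h₁ := hasSum_sq (pow_ne_zero 3 hx₀) (hpow three_ne_zero)
  rw [← pow_mul] at h₁
  have h₂ := h₁.mul_of_summable_norm (hasSum_hexForm (pow_ne_zero m hx₀) (hpow hm))
  refine hasSum_ncard_fiber (fun p => ?_) (h₂.congr_fun fun p => ?_)
  · simp only [hexForm]
    nlinarith [sq_nonneg p.1, mul_nonneg (Nat.cast_nonneg (α := ℤ) m)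
      (show 0 ≤ p.2.1 ^ 2 + p.2.1 * p.2.2 + p.2.2 ^ 2 by
        nlinarith [sq_nonneg (p.2.1 + p.2.2), sq_nonneg p.2.1, sq_nonneg p.2.2])]
  · rw [← zpow_natCast x 3, ← zpow_natCast x m, ← zpow_mul, ← zpow_mul, ← zpow_add₀ hx₀]
    norm_cast

lemma hasSum_ncard_three_squares (hx₀ : x ≠ 0) (hx : ‖x‖ < 1) :
    HasSum (fun n : ℕ => x ^ n * (s n : ℂ)) (thetaSeries (x ^ 2) x ^ 3) := by
  refine hasSum_ncard_fiber (fun p => by positivity)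
    ((hasSum_sq hx₀ hx).cube.congr_fun fun p => ?_)
  rw [← zpow_add₀ hx₀, ← zpow_add₀ hx₀, add_assoc]

lemma eq_zero_of_hasSum_pow_mul {c : ℕ → ℂ}
    (hc : ∀ x : ℂ, x ≠ 0 → ‖x‖ < 1 → HasSum (fun n => x ^ n * c n) 0) : c = 0 := by
  let g : ℂ → ℂ := fun x => if x = 0 then c 0 else 0
  have hg : HasFPowerSeriesAt g (FormalMultilinearSeries.ofScalars ℂ c) 0 := by
    rw [hasFPowerSeriesAt_iff]
    filter_upwards [Metric.ball_mem_nhds (0 : ℂ) one_pos] with x hx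
    simp only [zero_add, smul_eq_mul, FormalMultilinearSeries.coeff_ofScalars]
    by_cases hx₀ : x = 0
    · have := hasSum_single (f := fun n : ℕ => x ^ n * c n) 0
        fun n hn => by simp [hx₀, hn]
      simpa [g, hx₀] using this
    · simpa [g, hx₀] using hc x hx₀ (by simpa using hx)
  have hlim : Tendsto g (𝓝[≠] 0) (𝓝 (c 0)) := by
    have := hg.continuousAt.tendsto.mono_left (nhdsWithin_le_nhds (s := {0}ᶜ))
    simpa [g] using this
  have h₀ : c 0 = 0 := by
    refine tendsto_nhds_unique hlim (tendsto_const_nhds.congr' ?_)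
    filter_upwards [self_mem_nhdsWithin] with x hx
    exact (if_neg hx).symm
  have hp := hg.eq_zero_of_eventually (Eventually.of_forall fun x => by simp [g, h₀])
  funext n
  rw [← FormalMultilinearSeries.coeff_ofScalars (𝕜 := ℂ) (p := c) (n := n), hp]
  rfl

end generatingFunctions

lemma ncard_three_squares_add (n : ℕ) :
    s n + 2 * Set.ncard {p : ℤ × ℤ × ℤ | 3 * p.1 ^ 2 + 4 * hexForm p.2 = n} =
      2 * Set.ncard {p : ℤ × ℤ × ℤ | 3 * p.1 ^ 2 + 2 * hexForm p.2 = n} +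
        Set.ncard {p : ℤ × ℤ × ℤ | 3 * p.1 ^ 2 + hexForm p.2 = n} := by
  have h := eq_zero_of_hasSum_pow_mul (c := fun n : ℕ =>
    (s n + 2 * Set.ncard {p : ℤ × ℤ × ℤ | 3 * p.1 ^ 2 + (4 : ℕ) * hexForm p.2 = n} -
      (2 * Set.ncard {p : ℤ × ℤ × ℤ | 3 * p.1 ^ 2 + (2 : ℕ) * hexForm p.2 = n} +
        Set.ncard {p : ℤ × ℤ × ℤ | 3 * p.1 ^ 2 + (1 : ℕ) * hexForm p.2 = n}) : ℂ)) ?_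
  · have := sub_eq_zero.1 (congrFun h n)
    simp only [Nat.cast_one, one_mul, Nat.cast_ofNat] at this
    exact_mod_cast this
  · intro x hx₀ hx
    have h₁ := hasSum_ncard_three_squares hx₀ hx
    have h₂ := hasSum_theta_mul_hexTheta hx₀ hx (m := 4) (by norm_num)
    have h₃ := hasSum_theta_mul_hexTheta hx₀ hx (m := 2) (by norm_num)
    have h₄ := hasSum_theta_mul_hexTheta hx₀ hx (m := 1) (by norm_num)
    have key := thetaSeries_cube_eq (neg_ne_zero.2 hx₀) (by rwa [norm_neg])
    rw [hexTheta_neg hx₀ hx, neg_neg, Even.neg_pow (by decide), Even.neg_pow (by decide),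
      Odd.neg_pow (by decide), neg_neg] at key
    have h := (h₁.add (h₂.mul_left 2)).sub ((h₃.mul_left 2).add h₄)
    rw [pow_one] at h
    rw [key, show ∀ a b c d : ℂ, a * (2 * b - (2 * c - d)) + 2 * (a * c) -
      (2 * (a * b) + a * d) = 0 from fun a b c d => by ring] at h
    exact h.congr_fun fun n => by ring

section spheres

/-- The integral vectors of squared norm `n`. -/
def sphere (n : ℤ) : Set (ℤ × ℤ × ℤ) := {v | v.1 ^ 2 + v.2.1 ^ 2 + v.2.2 ^ 2 = n}

lemma mem_sphere {n : ℤ} {v : ℤ × ℤ × ℤ} :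
    v ∈ sphere n ↔ v.1 ^ 2 + v.2.1 ^ 2 + v.2.2 ^ 2 = n := Iff.rfl

lemma finite_sphere (n : ℤ) : (sphere n).Finite := by
  have h : (Set.Icc (-n) n).Finite := Set.finite_Icc _ _
  refine (h.prod (h.prod h)).subset fun v hv => ?_
  rw [mem_sphere] at hv
  have key : ∀ k m : ℤ, 0 ≤ m → k ^ 2 + m = n → k ∈ Set.Icc (-n) n := fun k m hm hk => by
    constructor <;> nlinarith [Int.le_self_sq k, Int.le_self_sq (-k)]
  exact ⟨key _ (v.2.1 ^ 2 + v.2.2 ^ 2) (by positivity) (by linarith),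
    key _ (v.1 ^ 2 + v.2.2 ^ 2) (by positivity) (by linarith),
    key _ (v.1 ^ 2 + v.2.1 ^ 2) (by positivity) (by linarith)⟩

/-- The vectors of squared norm `n` congruent modulo `3` to a nonzero multiple of
`(1, σ, τ)`, when `σ` and `τ` are signs. -/
def signedSphere (σ τ n : ℤ) : Set (ℤ × ℤ × ℤ) :=
  {v ∈ sphere n | ¬ 3 ∣ v.1 ∧ 3 ∣ v.1 - σ * v.2.1 ∧ 3 ∣ v.1 - τ * v.2.2}

lemma mem_signedSphere {σ τ n : ℤ} {v : ℤ × ℤ × ℤ} : v ∈ signedSphere σ τ n ↔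
    v ∈ sphere n ∧ ¬ 3 ∣ v.1 ∧ 3 ∣ v.1 - σ * v.2.1 ∧ 3 ∣ v.1 - τ * v.2.2 := Iff.rfl

lemma finite_signedSphere (σ τ n : ℤ) : (signedSphere σ τ n).Finite :=
  (finite_sphere n).subset fun _ hv => hv.1

lemma ncard_signedSphere {σ τ : ℤ} (hσ : σ ^ 2 = 1) (hτ : τ ^ 2 = 1) (n : ℤ) :
    (signedSphere σ τ n).ncard = (signedSphere 1 1 n).ncard := by
  have h : Function.Involutive fun v : ℤ × ℤ × ℤ => (v.1, σ * v.2.1, τ * v.2.2) := by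
    rintro ⟨a, b, c⟩
    simp only [← mul_assoc, ← sq, hσ, hτ, one_mul]
  rw [← Set.ncard_image_of_injective (signedSphere 1 1 n) h.injective,
    Set.image_eq_preimage_of_inverse h.leftInverse h.rightInverse]
  congr 1
  ext v
  simp only [mem_signedSphere, mem_sphere, Set.mem_preimage, mul_pow, hσ, hτ, one_mul]

lemma ncard_signedSphere_one (n : ℤ) :
    (signedSphere 1 1 (9 * n)).ncard =
      {v ∈ sphere n | ¬ 3 ∣ v.1 + v.2.1 + v.2.2}.ncard := by
  let g : ℤ × ℤ × ℤ → ℤ × ℤ × ℤ := fun v =>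
    (v.1 - 2 * (v.2.1 + v.2.2), v.2.1 - 2 * (v.1 + v.2.2), v.2.2 - 2 * (v.1 + v.2.1))
  have hg : Function.Injective g := by
    rintro ⟨a, b, c⟩ ⟨a', b', c'⟩ h
    simp only [g, Prod.mk.injEq] at h ⊢
    lia
  refine Eq.trans ?_ (Set.ncard_image_of_injective _ hg)
  congr 1
  ext ⟨a, b, c⟩
  simp only [mem_signedSphere, mem_sphere, Set.mem_image, Set.mem_ofPred_eq, one_mul]
  constructor
  · rintro ⟨h, ha, ⟨k, hk⟩, ⟨l, hl⟩⟩
    obtain rfl : b = a - 3 * k := by lia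
    obtain rfl : c = a - 3 * l := by lia
    have h₉ : 9 ∣ 3 * a - 2 * (a + (a - 3 * k) + (a - 3 * l)) := by
      have h₁ : 3 ∣ a * (a - 2 * (k + l)) := by
        refine ⟨n - k ^ 2 - l ^ 2, ?_⟩
        linarith
      have := (Int.prime_three.dvd_or_dvd h₁).resolve_left ha
      lia
    obtain ⟨m, hm⟩ := h₉
    refine ⟨(m, m - k, m - l), ⟨?_, ?_⟩, ?_⟩
    · simp only
      obtain ⟨rfl⟩ : a = 2 * (k + l) - 3 * m := by lia
      linarith
    · simp only
      lia
    · simp only [g, Prod.mk.injEq]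
      lia
  · rintro ⟨⟨x, y, z⟩, ⟨h, hs⟩, he⟩
    simp only [g, Prod.mk.injEq] at h hs he
    obtain ⟨rfl, rfl, rfl⟩ := he
    refine ⟨by linear_combination 9 * h, by lia, by lia, by lia⟩

lemma sphere_nine_mul (n : ℤ) :
    sphere (9 * n) = (fun v : ℤ × ℤ × ℤ => (3 * v.1, 3 * v.2.1, 3 * v.2.2)) '' sphere n ∪
      (signedSphere 1 1 (9 * n) ∪ signedSphere 1 (-1) (9 * n) ∪
        (signedSphere (-1) 1 (9 * n) ∪ signedSphere (-1) (-1) (9 * n))) := by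
  ext ⟨a, b, c⟩
  simp only [Set.mem_union, mem_signedSphere, mem_sphere, Set.mem_image]
  constructor
  · intro h
    have key : ∀ k : ℤ, 3 ∣ k ∧ k ^ 2 % 3 = 0 ∨ ¬ 3 ∣ k ∧ k ^ 2 % 3 = 1 := fun k => by
      obtain hk | hk | hk : k % 3 = 0 ∨ k % 3 = 1 ∨ k % 3 = 2 := by lia
      · exact Or.inl ⟨by lia, by simp [sq, Int.mul_emod, hk]⟩
      · exact Or.inr ⟨by lia, by simp [sq, Int.mul_emod, hk]⟩
      · exact Or.inr ⟨by lia, by simp [sq, Int.mul_emod, hk]⟩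
    simp only [h, true_and]
    by_cases ha : 3 ∣ a
    · obtain ⟨x, rfl⟩ := ha
      have h' : b ^ 2 + c ^ 2 = 3 * (3 * n - 3 * x ^ 2) := by linear_combination h
      obtain ⟨y, rfl⟩ : 3 ∣ b := by grind [key b, key c]
      obtain ⟨z, rfl⟩ : 3 ∣ c := by grind [key c]
      exact Or.inl ⟨(x, y, z), by linarith, rfl⟩
    · have hb : ¬ 3 ∣ b := by grind [key a, key b, key c]
      have hc : ¬ 3 ∣ c := by grind [key a, key b, key c]
      lia
  · rintro (⟨⟨x, y, z⟩, h, he⟩ | (h | h) | (h | h))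
    · simp only [Prod.mk.injEq] at h he
      obtain ⟨rfl, rfl, rfl⟩ := he
      linear_combination 9 * h
    all_goals exact h.1

lemma ncard_sphere_nine_mul (n : ℤ) :
    (sphere (9 * n)).ncard + 4 * {v ∈ sphere n | 3 ∣ v.1 + v.2.1 + v.2.2}.ncard =
      5 * (sphere n).ncard := by
  have hinj : Function.Injective fun v : ℤ × ℤ × ℤ => (3 * v.1, 3 * v.2.1, 3 * v.2.2) := by
    rintro ⟨a, b, c⟩ ⟨a', b', c'⟩ h
    simp only [Prod.mk.injEq] at h ⊢
    lia
  have hf := fun σ τ => finite_signedSphere σ τ (9 * n)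
  have hd : ∀ {σ τ σ' τ' : ℤ}, σ = 1 ∧ σ' = -1 ∨ τ = 1 ∧ τ' = -1 →
      Disjoint (signedSphere σ τ (9 * n)) (signedSphere σ' τ' (9 * n)) := by
    intro σ τ σ' τ' h
    refine Set.disjoint_left.2 fun v hv hv' => ?_
    rw [mem_signedSphere] at hv hv'
    rcases h with ⟨rfl, rfl⟩ | ⟨rfl, rfl⟩ <;> lia
  have hd₀ : ∀ σ τ, Disjoint
      ((fun v : ℤ × ℤ × ℤ => (3 * v.1, 3 * v.2.1, 3 * v.2.2)) '' sphere n)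
      (signedSphere σ τ (9 * n)) := by
    refine fun σ τ => Set.disjoint_left.2 ?_
    rintro _ ⟨v, -, rfl⟩ hv
    exact hv.2.1 (dvd_mul_right 3 v.1)
  have hs := ncard_signedSphere_one n
  have hadd : {v ∈ sphere n | 3 ∣ v.1 + v.2.1 + v.2.2}.ncard +
      {v ∈ sphere n | ¬ 3 ∣ v.1 + v.2.1 + v.2.2}.ncard = (sphere n).ncard :=
    Set.ncard_inter_add_ncard_sdiff_eq_ncard (sphere n)
      {v | 3 ∣ v.1 + v.2.1 + v.2.2} (finite_sphere n)
  have h₁ := Set.ncard_union_eq (hd (.inr ⟨rfl, rfl⟩)) (hf 1 1) (hf 1 (-1))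
  have h₂ := Set.ncard_union_eq (hd (.inr ⟨rfl, rfl⟩)) (hf (-1) 1) (hf (-1) (-1))
  have h₃ := Set.ncard_union_eq
    (Set.disjoint_union_left.2 ⟨Set.disjoint_union_right.2
      ⟨hd (.inl ⟨rfl, rfl⟩), hd (.inl ⟨rfl, rfl⟩)⟩, Set.disjoint_union_right.2
      ⟨hd (.inl ⟨rfl, rfl⟩), hd (.inl ⟨rfl, rfl⟩)⟩⟩)
    ((hf 1 1).union (hf 1 (-1))) ((hf (-1) 1).union (hf (-1) (-1)))
  have h₄ := Set.ncard_union_eq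
    (Set.disjoint_union_right.2 ⟨Set.disjoint_union_right.2 ⟨hd₀ 1 1, hd₀ 1 (-1)⟩,
      Set.disjoint_union_right.2 ⟨hd₀ (-1) 1, hd₀ (-1) (-1)⟩⟩)
    ((finite_sphere n).image _)
    (((hf 1 1).union (hf 1 (-1))).union ((hf (-1) 1).union (hf (-1) (-1))))
  rw [← sphere_nine_mul, Set.ncard_image_of_injective _ hinj] at h₄
  rw [ncard_signedSphere (σ := 1) (τ := -1) (by norm_num) (by norm_num)] at h₁
  rw [ncard_signedSphere (σ := -1) (τ := 1) (by norm_num) (by norm_num),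
    ncard_signedSphere (σ := -1) (τ := -1) (by norm_num) (by norm_num)] at h₂
  lia

lemma ncard_sphere_inter (n : ℤ) : {v ∈ sphere n | 3 ∣ v.1 + v.2.1 + v.2.2}.ncard =
    Set.ncard {p : ℤ × ℤ × ℤ | 3 * p.1 ^ 2 + 2 * hexForm p.2 = n} := by
  refine Eq.trans ?_ (Set.ncard_image_of_injective _ sumZeroMod_injective)
  congr 1
  ext v
  simp only [Set.mem_ofPred_eq, ← mem_range_sumZeroMod, mem_sphere, Set.mem_image]
  constructor
  · rintro ⟨h, p, rfl⟩
    refine ⟨p, ?_, rfl⟩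
    simp only [sumZeroMod, hexForm] at h ⊢
    linarith
  · rintro ⟨p, h, rfl⟩
    refine ⟨?_, p, rfl⟩
    simp only [sumZeroMod, hexForm] at h ⊢
    linarith

end spheres

lemma R_eq_ncard_hexForm (n : ℕ) :
    R 1 1 3 0 0 1 n = Set.ncard {p : ℤ × ℤ × ℤ | 3 * p.1 ^ 2 + hexForm p.2 = n} := by
  have hinj : Function.Injective fun v : ℤ × ℤ × ℤ => (v.2.2, v.1, v.2.1) := by
    rintro ⟨a, b, c⟩ ⟨a', b', c'⟩ h
    simp_all
  rw [R, ← Set.ncard_image_of_injective _ hinj]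
  congr 1
  ext ⟨z, x, y⟩
  simp only [hexForm, Set.mem_image, Set.mem_ofPred_eq, Prod.exists, Prod.mk.injEq]
  constructor
  · rintro ⟨_, _, _, h, rfl, rfl, rfl⟩
    linarith
  · intro h
    exact ⟨x, y, z, by linarith, rfl, rfl, rfl⟩

lemma R_eq_ncard_four_mul_hexForm (n : ℕ) :
    R 4 3 4 0 4 0 n = Set.ncard {p : ℤ × ℤ × ℤ | 3 * p.1 ^ 2 + 4 * hexForm p.2 = n} := by
  have hinj : Function.Injective fun v : ℤ × ℤ × ℤ => (v.2.1, v.1, v.2.2) := by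
    rintro ⟨a, b, c⟩ ⟨a', b', c'⟩ h
    simp_all
  rw [R, ← Set.ncard_image_of_injective _ hinj]
  congr 1
  ext ⟨y, x, z⟩
  simp only [hexForm, Set.mem_image, Set.mem_ofPred_eq, Prod.exists, Prod.mk.injEq]
  constructor
  · rintro ⟨_, _, _, h, rfl, rfl, rfl⟩
    linarith
  · intro h
    exact ⟨x, y, z, by linarith, rfl, rfl, rfl⟩

theorem sum_three_squares_nine (n : ℕ) :
    (s (9 * n) : ℤ) - 3 * (s n : ℤ) =
      2 * (R 1 1 3 0 0 1 n : ℤ) - 4 * (R 4 3 4 0 4 0 n : ℤ) := by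
  have h₁ := ncard_three_squares_add n
  have h₂ := ncard_sphere_nine_mul n
  have hs : ∀ m : ℕ, s m = (sphere m).ncard := fun m => rfl
  rw [ncard_sphere_inter, ← hs, show (9 * n : ℤ) = (9 * n : ℕ) by push_cast; rfl, ← hs] at h₂
  rw [← R_eq_ncard_hexForm, ← R_eq_ncard_four_mul_hexForm] at h₁
  lia
end

section
/- For every natural number n, s(25n) − 5·s(n) = 4·A(n) − 8·B(n), where A(n) is the number of triples (x,y,z) ∈ ℤ³ with 2x² + 2y² + 2z² − yz + zx + xy = n and B(n) is the number of triples (x,y,z) ∈ ℤ³ with 7x² + 8y² + 8z² − 4yz + 8zx + 8xy = n. -/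
open Filter Topology Finset

/-- The infinite `q`-Pochhammer symbol `(z; q)_∞`. -/
noncomputable def qPoch (z q : ℝ) : ℝ := ∏' n : ℕ, (1 - z * q ^ n)

theorem summable_norm_qPoch (z : ℝ) {q : ℝ} (hq : |q| < 1) :
    Summable fun n : ℕ => ‖-(z * q ^ n)‖ := by
  simpa [abs_mul, abs_pow] using
    (summable_geometric_of_lt_one (abs_nonneg q) hq).mul_left |z|

theorem hasProd_qPoch (z : ℝ) {q : ℝ} (hq : |q| < 1) :
    HasProd (fun n : ℕ => 1 - z * q ^ n) (qPoch z q) := by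
  have h := multipliable_one_add_of_summable (summable_norm_qPoch z hq)
  simpa only [qPoch, ← sub_eq_add_neg] using h.hasProd

theorem one_sub_mul_pow_pos {z q : ℝ} (hz : |z| < 1) (hq : |q| < 1) (n : ℕ) :
    0 < 1 - z * q ^ n := by
  have h : |z * q ^ n| < 1 := by
    rw [abs_mul, abs_pow]
    exact mul_lt_one_of_nonneg_of_lt_one_left (abs_nonneg z) hz (pow_le_one₀ (abs_nonneg q) hq.le)
  linarith [(abs_lt.1 h).2]

theorem qPoch_pos {z q : ℝ} (hz : |z| < 1) (hq : |q| < 1) : 0 < qPoch z q := by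
  have h0 : qPoch z q ≠ 0 := by
    have := tprod_one_add_ne_zero_of_summable (f := fun n : ℕ => -(z * q ^ n))
      (fun n => by rw [← sub_eq_add_neg]; exact (one_sub_mul_pow_pos hz hq n).ne')
      (summable_norm_qPoch z hq)
    simpa only [qPoch, ← sub_eq_add_neg] using this
  refine lt_of_le_of_ne ?_ h0.symm
  exact ge_of_tendsto' (hasProd_qPoch z hq).tendsto_prod_nat
    fun n => prod_nonneg fun i _ => (one_sub_mul_pow_pos hz hq i).le

/-- Splitting the factors of `(z; q)_∞` by residue class modulo `m`. -/
theorem qPoch_eq_prod (m : ℕ) [NeZero m] (z : ℝ) {q : ℝ} (hq : |q| < 1) :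
    qPoch z q = ∏ i : Fin m, qPoch (z * q ^ (i : ℕ)) (q ^ m) := by
  have hqm : |q ^ m| < 1 := by
    rw [abs_pow]; exact pow_lt_one₀ (abs_nonneg q) hq (NeZero.ne m)
  have h1 := (((Nat.divModEquiv m).trans (Equiv.prodComm _ _)).symm.hasProd_iff).2
    (hasProd_qPoch z hq)
  have h2 := h1.prod_fiberwise (g := fun i : Fin m => qPoch (z * q ^ (i : ℕ)) (q ^ m))
    (fun i => by
      refine (hasProd_qPoch (z * q ^ (i : ℕ)) hqm).congr_fun ?_
      intro n
      simp [Nat.divModEquiv, pow_add, pow_mul, mul_comm, mul_assoc])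
  exact h2.unique (hasProd_fintype _)

theorem qPoch_mul_qPoch_neg (z : ℝ) {q : ℝ} (hq : |q| < 1) :
    qPoch z q * qPoch (-z) q = qPoch (z ^ 2) (q ^ 2) := by
  have hq2 : |q ^ 2| < 1 := by
    rw [abs_pow]; exact pow_lt_one₀ (abs_nonneg q) hq two_ne_zero
  refine ((hasProd_qPoch z hq).mul (hasProd_qPoch (-z) hq)).unique ?_
  refine (hasProd_qPoch (z ^ 2) hq2).congr_fun fun n => ?_
  ring

/-- Gaussian binomial coefficients evaluated at `q`. -/
def qChoose (q : ℝ) : ℕ → ℕ → ℝ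
  | _, 0 => 1
  | 0, _ + 1 => 0
  | n + 1, k + 1 => qChoose q n k + q ^ (k + 1) * qChoose q n (k + 1)

theorem qChoose_eq_zero (q : ℝ) : ∀ {n k : ℕ}, n < k → qChoose q n k = 0
  | 0, _ + 1, _ => by simp [qChoose]
  | n + 1, k + 1, h => by
    rw [qChoose, qChoose_eq_zero q (by omega : n < k), qChoose_eq_zero q (by omega : n < k + 1)]
    simp

theorem qChoose_add_mul (q : ℝ) : ∀ a b : ℕ,
    qChoose q (a + b) a * ((∏ i ∈ range a, (1 - q * q ^ i)) * ∏ i ∈ range b, (1 - q * q ^ i)) =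
      ∏ i ∈ range (a + b), (1 - q * q ^ i)
  | 0, b => by cases b <;> simp [qChoose]
  | a + 1, 0 => by
    have h := qChoose_add_mul q a 0
    rw [add_zero, qChoose, qChoose_eq_zero q (Nat.lt_succ_self a)]
    rw [prod_range_succ]
    simp only [add_zero, range_zero, prod_empty, mul_one] at h ⊢
    linear_combination (1 - q * q ^ a) * h
  | a + 1, b + 1 => by
    have h1 := qChoose_add_mul q a (b + 1)
    have h2 := qChoose_add_mul q (a + 1) b
    rw [show a + 1 + (b + 1) = (a + (b + 1)) + 1 by ring, qChoose, prod_range_succ _ (a + (b + 1)),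
      prod_range_succ _ a, prod_range_succ _ b]
    rw [show a + 1 + b = a + (b + 1) by ring] at h2
    rw [prod_range_succ _ b] at h1
    rw [prod_range_succ _ a] at h2
    rw [pow_add q a (b + 1)]
    linear_combination (1 - q * q ^ a) * h1 + q ^ (a + 1) * (1 - q * q ^ b) * h2

/-- The `q`-binomial theorem. -/
theorem prod_one_add_mul_pow (q : ℝ) (n : ℕ) : ∀ x : ℝ,
    ∏ i ∈ range n, (1 + x * q ^ i) =
      ∑ k ∈ range (n + 1), qChoose q n k * q ^ (k.choose 2) * x ^ k := by
  induction n with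
  | zero => intro x; simp [qChoose]
  | succ n ih =>
    intro x
    have h : ∏ i ∈ range n, (1 + x * q ^ (i + 1)) = ∏ i ∈ range n, (1 + (x * q) * q ^ i) :=
      prod_congr rfl fun i _ => by ring
    rw [prod_range_succ', h, ih, sum_range_succ' _ (n + 1)]
    have e : ∑ k ∈ range (n + 1), qChoose q (n + 1) (k + 1) * q ^ ((k + 1).choose 2) * x ^ (k + 1) =
        ∑ k ∈ range (n + 1), x * (qChoose q n k * q ^ (k.choose 2) * (x * q) ^ k) +
        ∑ k ∈ range (n + 1), qChoose q n (k + 1) * q ^ ((k + 1).choose 2) * (x * q) ^ (k + 1) := by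
      rw [← sum_add_distrib]
      refine sum_congr rfl fun k _ => ?_
      rw [qChoose, Nat.choose_succ_succ' k 1, Nat.choose_one_right, mul_pow, mul_pow]
      ring
    have e2 : ∑ k ∈ range (n + 1), qChoose q n k * q ^ (k.choose 2) * (x * q) ^ k =
        ∑ k ∈ range (n + 1), qChoose q n (k + 1) * q ^ ((k + 1).choose 2) * (x * q) ^ (k + 1)
          + 1 := by
      have := sum_range_succ' (fun k => qChoose q n k * q ^ (k.choose 2) * (x * q) ^ k) (n + 1)
      rw [sum_range_succ, qChoose_eq_zero q (Nat.lt_succ_self n)] at this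
      simpa [qChoose] using this
    rw [e, ← mul_sum]
    have : qChoose q (n + 1) 0 = 1 := by simp [qChoose]
    rw [this]
    simp only [Nat.choose_zero_succ, pow_zero, mul_one]
    linear_combination e2

theorem Int.cast_choose_two_eq_ediv (k : ℕ) : ((k.choose 2 : ℕ) : ℤ) = (k : ℤ) * (k - 1) / 2 := by
  rw [Nat.choose_two_right, Int.natCast_div, Nat.cast_mul]
  rcases k with _ | k <;> simp

theorem Int.two_mul_triangle (n : ℤ) : 2 * (n * (n - 1) / 2) = n * (n - 1) :=
  Int.mul_ediv_cancel' (Int.even_mul_pred_self n).two_dvd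

theorem prod_one_add_mul_pow_mul_prod {z q : ℝ} (hz : z ≠ 0) (hq : q ≠ 0) (N : ℕ) :
    (∏ i ∈ range N, (1 - -z * q ^ i)) * ∏ i ∈ range N, (1 - -(q / z) * q ^ i) =
      ∑ k ∈ range (2 * N + 1), qChoose q (2 * N) k *
        (z ^ ((k : ℤ) - N) * q ^ (((k : ℤ) - N) * ((k : ℤ) - N - 1) / 2)) := by
  have key := prod_one_add_mul_pow q (2 * N) (z * (q ^ N)⁻¹)
  have h1 : ∏ i ∈ range (2 * N), (1 + z * (q ^ N)⁻¹ * q ^ i) =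
      (∏ i ∈ range N, (1 - -z * q ^ i)) * (∏ i ∈ range N, (1 - -(q / z) * q ^ i)) *
        (z ^ N * (q ^ ((N + 1).choose 2))⁻¹) := by
    have a : ∏ i ∈ range N, (1 + z * (q ^ N)⁻¹ * q ^ i) =
        (∏ i ∈ range N, (1 - -(q / z) * q ^ i)) * (z ^ N * (q ^ ((N + 1).choose 2))⁻¹) := by
      rw [← prod_range_reflect]
      have e : (z ^ N * (q ^ ((N + 1).choose 2))⁻¹) = ∏ i ∈ range N, (z * (q ^ (i + 1))⁻¹) := by
        clear key
        induction N with
        | zero => simp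
        | succ n ih =>
          rw [prod_range_succ, ← ih, Nat.choose_succ_succ' (n + 1) 1, Nat.choose_one_right]
          simp only [pow_add, mul_inv, pow_one]
          ring
      rw [e, ← prod_mul_distrib]
      refine prod_congr rfl fun i hi => ?_
      have hi' := mem_range.1 hi
      have : q ^ N = q ^ (N - 1 - i) * q ^ (i + 1) := by rw [← pow_add]; congr 1; omega
      rw [this]
      field_simp
      ring
    have b : ∏ i ∈ range N, (1 + z * (q ^ N)⁻¹ * q ^ (N + i)) = ∏ i ∈ range N, (1 - -z * q ^ i) :=
      prod_congr rfl fun i _ => by rw [pow_add]; field_simp; ring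
    rw [two_mul, prod_range_add, a, b]
    ring
  rw [h1] at key
  have hne : z ^ N * (q ^ ((N + 1).choose 2))⁻¹ ≠ 0 := by positivity
  refine mul_right_cancel₀ hne (key.trans ?_)
  rw [sum_mul]
  refine sum_congr rfl fun k _ => ?_
  have hz' : z ^ k = z ^ ((k : ℤ) - N) * z ^ N := by
    rw [← zpow_natCast, ← zpow_natCast, ← zpow_add₀ hz]; congr 1; ring
  have hq' : q ^ (k.choose 2) * ((q ^ N)⁻¹) ^ k =
      q ^ (((k : ℤ) - N) * ((k : ℤ) - N - 1) / 2) * (q ^ ((N + 1).choose 2))⁻¹ := by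
    rw [← zpow_natCast, ← zpow_natCast, ← zpow_natCast, ← zpow_natCast, ← zpow_neg, ← zpow_neg,
      ← zpow_mul, ← zpow_add₀ hq, ← zpow_add₀ hq]
    congr 1
    have t1 := Int.two_mul_triangle k
    have t2 := Int.two_mul_triangle ((k : ℤ) - N)
    have t3 := Int.two_mul_triangle ((N + 1 : ℕ) : ℤ)
    rw [Int.cast_choose_two_eq_ediv, Int.cast_choose_two_eq_ediv]
    push_cast at t3 ⊢
    linarith
  rw [mul_pow, hz']
  linear_combination (qChoose q (2 * N) k * (z ^ ((k : ℤ) - N) * z ^ N)) * hq'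

theorem summable_abs_jacobi {z q : ℝ} (hz : z ≠ 0) (hq : q ≠ 0) (hq1 : |q| < 1) :
    Summable fun n : ℤ => |z ^ n * q ^ (n * (n - 1) / 2)| := by
  have step : ∀ n : ℤ, z ^ (n + 1) * q ^ ((n + 1) * (n + 1 - 1) / 2) =
      z * q ^ n * (z ^ n * q ^ (n * (n - 1) / 2)) := by
    intro n
    have : (n + 1) * (n + 1 - 1) / 2 = n + n * (n - 1) / 2 := by
      have t1 := Int.two_mul_triangle n
      have t2 := Int.two_mul_triangle (n + 1)
      linarith
    rw [this, zpow_add₀ hz, zpow_add₀ hq, zpow_one]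
    ring
  have lim := tendsto_pow_atTop_nhds_zero_of_abs_lt_one hq1
  apply Summable.of_nat_of_neg
  · refine summable_of_ratio_test_tendsto_lt_one (l := 0) one_pos
      (Eventually.of_forall fun n => by positivity) ?_
    have : Tendsto (fun n : ℕ => |z * q ^ n|) atTop (𝓝 0) := by
      simpa using (lim.const_mul z).abs
    refine this.congr fun n => ?_
    have h := step n
    have hne : |z ^ (n : ℤ) * q ^ ((n : ℤ) * (n - 1) / 2)| ≠ 0 := by positivity
    rw [Real.norm_eq_abs, Real.norm_eq_abs, abs_abs, abs_abs, Nat.cast_succ, h, abs_mul (z * _),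
      mul_div_assoc, div_self hne, mul_one, zpow_natCast]
  · refine summable_of_ratio_test_tendsto_lt_one (l := 0) one_pos
      (Eventually.of_forall fun n => by positivity) ?_
    have : Tendsto (fun n : ℕ => |z⁻¹ * q ^ (n + 1)|) atTop (𝓝 0) := by
      simpa using ((lim.comp (tendsto_add_atTop_nat 1)).const_mul z⁻¹).abs
    refine this.congr fun n => ?_
    have h := step (-((n + 1 : ℕ) : ℤ))
    have hne : |z ^ (-(n : ℤ)) * q ^ ((-(n : ℤ)) * (-(n : ℤ) - 1) / 2)| ≠ 0 := by positivity
    have e : (-((n + 1 : ℕ) : ℤ)) + 1 = -(n : ℤ) := by push_cast; ring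
    rw [e] at h
    rw [Real.norm_eq_abs, Real.norm_eq_abs, abs_abs, abs_abs, eq_div_iff hne, ← abs_mul, h]
    congr 1
    rw [zpow_neg q, zpow_natCast]
    field_simp

/-- The Jacobi triple product identity. -/
theorem hasSum_jacobi_triple_product {z q : ℝ} (hz : z ≠ 0) (hq : q ≠ 0) (hq1 : |q| < 1) :
    HasSum (fun n : ℤ => z ^ n * q ^ (n * (n - 1) / 2))
      (qPoch q q * qPoch (-z) q * qPoch (-(q / z)) q) := by
  set P : ℕ → ℝ := fun k => ∏ i ∈ range k, (1 - q * q ^ i) with hP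
  have hPpos : ∀ k, 0 < P k := fun k => prod_pos fun i _ => one_sub_mul_pow_pos hq1 hq1 i
  have hPlim : Tendsto P atTop (𝓝 (qPoch q q)) := (hasProd_qPoch q hq1).tendsto_prod_nat
  have hpos := qPoch_pos hq1 hq1
  obtain ⟨K, hK⟩ := hPlim.bddAbove_range
  obtain ⟨L, hL⟩ := (hPlim.inv₀ hpos.ne').bddAbove_range
  replace hK : ∀ k, P k ≤ K := fun k => hK ⟨k, rfl⟩
  replace hL : ∀ k, (P k)⁻¹ ≤ L := fun k => hL ⟨k, rfl⟩
  have hL0 : 0 < L := (inv_pos.2 (hPpos 0)).trans_le (hL 0)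
  have hK0 : 0 < K := (hPpos 0).trans_le (hK 0)
  set c : ℕ → ℤ → ℝ := fun N n =>
    if n ∈ Icc (-(N : ℤ)) N then qChoose q (2 * N) (n + N).toNat else 0 with hc
  have hcP : ∀ (N : ℕ) (n : ℤ), n ∈ Icc (-(N : ℤ)) N →
      c N n = P (2 * N) * (P (n + N).toNat)⁻¹ * (P (N - n).toNat)⁻¹ := by
    intro N n hn
    have hn' := mem_Icc.1 hn
    have h := qChoose_add_mul q (n + N).toNat (N - n).toNat
    rw [show (n + N).toNat + (N - n).toNat = 2 * N by omega] at h
    have h1 := (hPpos (n + N).toNat).ne'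
    have h2 := (hPpos (N - n).toNat).ne'
    simp only [hc, if_pos hn]
    change _ * (P _ * P _) = P _ at h
    rw [← h]
    field_simp
  have hlim : ∀ n, Tendsto (fun N => c N n) atTop (𝓝 (qPoch q q)⁻¹) := by
    intro n
    have t0 : Tendsto (fun N : ℕ => 2 * N) atTop atTop :=
      tendsto_atTop_mono (fun N => Nat.le_mul_of_pos_left N two_pos) tendsto_id
    have t1 : Tendsto (fun N : ℕ => (n + N).toNat) atTop atTop :=
      tendsto_atTop_mono (f := fun N : ℕ => N - n.natAbs) (fun N => by omega)
        (tendsto_sub_atTop_nat _)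
    have t2 : Tendsto (fun N : ℕ => (N - n).toNat) atTop atTop :=
      tendsto_atTop_mono (f := fun N : ℕ => N - n.natAbs) (fun N => by omega)
        (tendsto_sub_atTop_nat _)
    have := ((hPlim.comp t0).mul ((hPlim.comp t1).inv₀ hpos.ne')).mul
      ((hPlim.comp t2).inv₀ hpos.ne')
    rw [mul_inv_cancel₀ hpos.ne', one_mul] at this
    refine this.congr' ?_
    filter_upwards [eventually_ge_atTop n.natAbs] with N hN
    exact (hcP N n (mem_Icc.2 (by omega))).symm
  have hbound : ∀ N n, |c N n| ≤ K * L * L := by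
    intro N n
    by_cases hn : n ∈ Icc (-(N : ℤ)) N
    · have h1 := inv_pos.2 (hPpos (n + N).toNat)
      have h2 := inv_pos.2 (hPpos (N - n).toNat)
      have h0 := hPpos (2 * N)
      rw [hcP N n hn, abs_of_pos (by positivity)]
      gcongr
      exacts [hK _, hL _, hL _]
    · simp only [hc, if_neg hn, abs_zero]
      positivity
  have hs := summable_abs_jacobi hz hq hq1
  have hfin : ∀ N : ℕ, ∑' n : ℤ, c N n * (z ^ n * q ^ (n * (n - 1) / 2)) =
      (∏ i ∈ range N, (1 - -z * q ^ i)) * ∏ i ∈ range N, (1 - -(q / z) * q ^ i) := by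
    intro N
    rw [prod_one_add_mul_pow_mul_prod hz hq, tsum_eq_sum (s := Icc (-(N : ℤ)) N)
      (fun n hn => by simp only [hc, if_neg hn, zero_mul])]
    refine sum_nbij' (fun n => (n + N).toNat) (fun k => (k : ℤ) - N) ?_ ?_ ?_ ?_ ?_
    · intro n hn; have := mem_Icc.1 hn; rw [mem_range]; omega
    · intro k hk; have := mem_range.1 hk; rw [mem_Icc]; omega
    · intro n hn; have := mem_Icc.1 hn; omega
    · intro k hk; omega
    · intro n hn
      have := mem_Icc.1 hn
      have e : (((n + N).toNat : ℕ) : ℤ) - N = n := by omega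
      simp only [hc, if_pos hn, e]
  have T1 : Tendsto (fun N => ∑' n : ℤ, c N n * (z ^ n * q ^ (n * (n - 1) / 2))) atTop
      (𝓝 (∑' n : ℤ, (qPoch q q)⁻¹ * (z ^ n * q ^ (n * (n - 1) / 2)))) := by
    refine tendsto_tsum_of_dominated_convergence (hs.mul_left (K * L * L))
      (fun n => (hlim n).mul_const _) (Eventually.of_forall fun N n => ?_)
    rw [Real.norm_eq_abs, abs_mul]
    gcongr
    exact hbound N n
  have T2 := (hasProd_qPoch (-z) hq1).tendsto_prod_nat.mul
    (hasProd_qPoch (-(q / z)) hq1).tendsto_prod_nat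
  simp only [hfin] at T1
  have := tendsto_nhds_unique T1 T2
  rw [tsum_mul_left, inv_mul_eq_iff_eq_mul₀ hpos.ne', ← mul_assoc] at this
  rw [← this]
  exact hs.of_abs.hasSum

theorem abs_pow_lt_one {q : ℝ} (hq1 : |q| < 1) {k : ℕ} (hk : k ≠ 0) : |q ^ k| < 1 := by
  rw [abs_pow]; exact pow_lt_one₀ (abs_nonneg q) hq1 hk

/-- The Euler function `(q; q)_∞`. -/
noncomputable def euler (q : ℝ) : ℝ := qPoch q q

theorem euler_pos {q : ℝ} (hq1 : |q| < 1) : 0 < euler q := qPoch_pos hq1 hq1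

theorem qPoch_sq {q : ℝ} (hq1 : |q| < 1) : qPoch q (q ^ 2) = euler q / euler (q ^ 2) := by
  rw [eq_div_iff (euler_pos (abs_pow_lt_one hq1 two_ne_zero)).ne', euler, euler,
    qPoch_eq_prod 2 q hq1, Fin.prod_univ_two]
  norm_num [sq]

theorem euler_neg_mul {q : ℝ} (hq1 : |q| < 1) :
    euler (-q) * (euler q * euler (q ^ 4)) = euler (q ^ 2) ^ 3 := by
  have h2 := euler_pos (abs_pow_lt_one hq1 two_ne_zero)
  have h4 := euler_pos (abs_pow_lt_one hq1 (k := 4) (by norm_num))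
  have a := qPoch_sq hq1
  have b := qPoch_sq (q := -q) (by rwa [abs_neg])
  have c := qPoch_sq (abs_pow_lt_one hq1 two_ne_zero)
  have d := qPoch_mul_qPoch_neg q (abs_pow_lt_one hq1 two_ne_zero)
  rw [neg_sq] at b
  rw [a, b, c, ← pow_mul] at d
  field_simp at d
  norm_num at d
  linear_combination d

/-- Ramanujan's theta function `φ(q) = ∑ q ^ n²`. -/
noncomputable def phi (q : ℝ) : ℝ := ∑' n : ℤ, q ^ (n ^ 2)

/-- Ramanujan's theta function `ψ(q) = ∑ q ^ (2 n² + n)`. -/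
noncomputable def psi (q : ℝ) : ℝ := ∑' n : ℤ, q ^ (2 * n ^ 2 + n)

theorem hasSum_jacobi_pow {q : ℝ} (hq : q ≠ 0) (hq1 : |q| < 1) {k : ℕ} (hk : k ≠ 0) (j : ℕ) :
    HasSum (fun n : ℤ => q ^ (j * n + k * (n * (n - 1) / 2)))
      (euler (q ^ k) * qPoch (-q ^ j) (q ^ k) * qPoch (-(q ^ k / q ^ j)) (q ^ k)) := by
  refine (hasSum_jacobi_triple_product (pow_ne_zero j hq) (pow_ne_zero k hq)
    (abs_pow_lt_one hq1 hk)).congr_fun fun n => ?_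
  rw [← zpow_natCast, ← zpow_natCast, ← zpow_mul, ← zpow_mul, ← zpow_add₀ hq]

theorem hasSum_phi_aux {q : ℝ} (hq : q ≠ 0) (hq1 : |q| < 1) :
    HasSum (fun n : ℤ => q ^ (n ^ 2)) (euler (-q) ^ 2 / euler (q ^ 2)) := by
  have h2 := euler_pos (abs_pow_lt_one hq1 two_ne_zero)
  have h := hasSum_jacobi_pow hq hq1 two_ne_zero 1
  have e : q ^ 2 / q ^ 1 = q := by field_simp
  have b := qPoch_sq (q := -q) (by rwa [abs_neg])
  rw [neg_sq] at b
  rw [e, pow_one, b] at h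
  convert h using 1
  · funext n
    congr 1
    have := Int.two_mul_triangle n
    push_cast
    linarith
  · field_simp

theorem hasSum_phi {q : ℝ} (hq : q ≠ 0) (hq1 : |q| < 1) :
    HasSum (fun n : ℤ => q ^ (n ^ 2)) (phi q) :=
  (hasSum_phi_aux hq hq1).summable.hasSum

theorem phi_eq {q : ℝ} (hq : q ≠ 0) (hq1 : |q| < 1) :
    phi q = euler (-q) ^ 2 / euler (q ^ 2) :=
  (hasSum_phi_aux hq hq1).tsum_eq

theorem phi_neg_eq {q : ℝ} (hq : q ≠ 0) (hq1 : |q| < 1) :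
    phi (-q) = euler q ^ 2 / euler (q ^ 2) := by
  rw [phi_eq (neg_ne_zero.2 hq) (by rwa [abs_neg]), neg_neg, neg_sq]

theorem hasSum_psi_aux {q : ℝ} (hq : q ≠ 0) (hq1 : |q| < 1) :
    HasSum (fun n : ℤ => q ^ (2 * n ^ 2 + n)) (euler (-q) * euler (q ^ 4) / euler (q ^ 2)) := by
  have h2 := euler_pos (abs_pow_lt_one hq1 two_ne_zero)
  have h := hasSum_jacobi_pow hq hq1 four_ne_zero 3
  have e : q ^ 4 / q ^ 3 = q := by field_simp
  have b := qPoch_sq (q := -q) (by rwa [abs_neg])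
  rw [neg_sq, qPoch_eq_prod 2 _ (abs_pow_lt_one hq1 two_ne_zero), Fin.prod_univ_two] at b
  have e' : -q * (q ^ 2) ^ ((1 : Fin 2) : ℕ) = -q ^ 3 := by norm_num; ring
  have e'' : -q * (q ^ 2) ^ ((0 : Fin 2) : ℕ) = -q := by norm_num
  rw [e', e'', show (q ^ 2) ^ 2 = q ^ 4 by ring] at b
  rw [e, mul_assoc, mul_comm (qPoch _ _), b] at h
  convert h using 1
  · funext n
    congr 1
    have := Int.two_mul_triangle n
    push_cast
    linarith
  · field_simp

theorem hasSum_psi {q : ℝ} (hq : q ≠ 0) (hq1 : |q| < 1) :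
    HasSum (fun n : ℤ => q ^ (2 * n ^ 2 + n)) (psi q) :=
  (hasSum_psi_aux hq hq1).summable.hasSum

theorem psi_eq {q : ℝ} (hq : q ≠ 0) (hq1 : |q| < 1) :
    psi q = euler (-q) * euler (q ^ 4) / euler (q ^ 2) :=
  (hasSum_psi_aux hq hq1).tsum_eq

theorem psi_sq_eq {q : ℝ} (hq : q ≠ 0) (hq1 : |q| < 1) :
    psi (q ^ 2) = euler (q ^ 4) ^ 2 / euler (q ^ 2) := by
  have hq2 := abs_pow_lt_one hq1 two_ne_zero
  have h := euler_neg_mul hq2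
  have h2 := euler_pos hq2
  have h4 := euler_pos (abs_pow_lt_one hq1 four_ne_zero)
  rw [psi_eq (pow_ne_zero 2 hq) hq2, div_eq_div_iff (by rw [← pow_mul]; exact h4.ne') h2.ne']
  rw [← pow_mul, ← pow_mul] at h ⊢
  norm_num at h ⊢
  linear_combination h

/-- Euler's pentagonal number theorem. -/
theorem hasSum_euler {q : ℝ} (hq : q ≠ 0) (hq1 : |q| < 1) :
    HasSum (fun n : ℤ => (-1) ^ n * q ^ (n + 3 * (n * (n - 1) / 2))) (euler q) := by
  have h := hasSum_jacobi_triple_product (neg_ne_zero.2 hq) (pow_ne_zero 3 hq)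
    (abs_pow_lt_one hq1 three_ne_zero)
  have e : euler q = qPoch (q ^ 3) (q ^ 3) * qPoch (- -q) (q ^ 3) *
      qPoch (-(q ^ 3 / -q)) (q ^ 3) := by
    rw [euler, qPoch_eq_prod 3 q hq1, Fin.prod_univ_three, neg_neg]
    have e1 : -(q ^ 3 / -q) = q ^ 2 := by field_simp
    rw [e1]
    simp only [Fin.val_zero, Fin.val_one, Fin.val_two]
    ring_nf
  rw [e]
  refine h.congr_fun fun n => ?_
  rw [neg_eq_neg_one_mul q, mul_zpow, ← zpow_natCast q 3, ← zpow_mul, zpow_add₀ hq]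
  simp only [Nat.cast_ofNat]
  ring

theorem exists_hasSum_quintic {q : ℝ} (hq : q ≠ 0) (hq1 : |q| < 1) :
    ∃ u v : ℝ, HasSum (fun n : ℤ => q ^ (5 * n ^ 2 + 4 * n)) u ∧
      HasSum (fun n : ℤ => q ^ (5 * n ^ 2 + 2 * n)) v ∧
      u * v * (euler (q ^ 2) * euler (-q ^ 5)) = euler (q ^ 10) ^ 3 * euler (-q) := by
  have h9 := hasSum_jacobi_pow hq hq1 (k := 10) (by norm_num) 9
  have h7 := hasSum_jacobi_pow hq hq1 (k := 10) (by norm_num) 7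
  have e9 : q ^ 10 / q ^ 9 = q := by field_simp
  have e7 : q ^ 10 / q ^ 7 = q ^ 3 := by field_simp
  rw [e9] at h9
  rw [e7] at h7
  refine ⟨_, _, h9.congr_fun fun n => ?_, h7.congr_fun fun n => ?_, ?_⟩
  · congr 1
    have := Int.two_mul_triangle n
    push_cast
    linarith
  · congr 1
    have := Int.two_mul_triangle n
    push_cast
    linarith
  · have hq2 := abs_pow_lt_one hq1 two_ne_zero
    have hq5 := abs_pow_lt_one hq1 (k := 5) (by norm_num)
    have hq10 := abs_pow_lt_one hq1 (k := 10) (by norm_num)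
    have h2 := euler_pos hq2
    have h10 := euler_pos hq10
    have b := qPoch_sq (q := -q) (by rwa [abs_neg])
    have b5 := qPoch_sq (q := -q ^ 5) (by rwa [abs_neg])
    rw [neg_sq, qPoch_eq_prod 5 _ hq2, Fin.prod_univ_five] at b
    rw [neg_sq, ← pow_mul] at b5
    norm_num [← pow_mul] at b b5
    have r1 : q * q ^ 2 = q ^ 3 := by ring
    have r2 : q * q ^ 4 = q ^ 5 := by ring
    have r3 : q * q ^ 6 = q ^ 7 := by ring
    have r4 : q * q ^ 8 = q ^ 9 := by ring
    rw [r1, r2, r3, r4, b5] at b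
    field_simp at b
    linear_combination euler (q ^ 10) ^ 2 * b

theorem HasSum.of_residues {α β κ : Type*} [Fintype κ] {e : β × κ → α} (he : e.Bijective)
    {f : α → ℝ} {v : κ → ℝ} (h : ∀ r, HasSum (fun b => f (e (b, r))) (v r)) :
    HasSum f (∑ r, v r) := by
  classical
  rw [← (Equiv.ofBijective e he).hasSum_iff]
  have h' : ∀ r, HasSum (fun p : β × κ => if p.2 = r then f (e p) else 0) (v r) := by
    intro r
    have hi : Function.Injective fun b : β => (b, r) := fun a b hab => congrArg Prod.fst hab
    rw [← hi.hasSum_iff]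
    · simpa [Function.comp_def] using h r
    · rintro ⟨b, r'⟩ hb
      exact if_neg fun hr => hb ⟨b, by simp_all⟩
  refine (hasSum_sum fun r _ => h' r).congr_fun fun p => ?_
  simp

theorem HasSum.mul_real {ι κ : Type*} {f : ι → ℝ} {g : κ → ℝ} {a b : ℝ} (hf : HasSum f a)
    (hg : HasSum g b) : HasSum (fun p : ι × κ => f p.1 * g p.2) (a * b) :=
  hf.mul hg (summable_mul_of_summable_norm hf.summable.norm hg.summable.norm)

theorem HasSum.zpow_mul {ι κ : Type*} {q : ℝ} (hq : q ≠ 0) {f : ι → ℤ} {g : κ → ℤ} {a b : ℝ}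
    (hf : HasSum (fun i => q ^ f i) a) (hg : HasSum (fun i => q ^ g i) b) :
    HasSum (fun p : ι × κ => q ^ (f p.1 + g p.2)) (a * b) :=
  (hf.mul_real hg).congr_fun fun _ => zpow_add₀ hq _ _

theorem HasSum.zpow_shift {ι : Type*} {q : ℝ} (hq : q ≠ 0) {f : ι → ℤ} {a : ℝ}
    (hf : HasSum (fun i => q ^ f i) a) (k : ℤ) : HasSum (fun i => q ^ (f i + k)) (q ^ k * a) :=
  (hf.mul_left (q ^ k)).congr_fun fun p => by rw [zpow_add₀ hq, mul_comm]

theorem HasSum.zpow_bij {ι κ : Type*} {q : ℝ} {f : ι → ℤ} {g : κ → ℤ} {a : ℝ}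
    (hf : HasSum (fun i => q ^ f i) a) {e : ι → κ} (he : e.Bijective)
    (hfg : ∀ i, g (e i) = f i) : HasSum (fun i => q ^ g i) a := by
  rw [← (Equiv.ofBijective e he).hasSum_iff]
  exact hf.congr_fun fun i => congrArg (q ^ ·) (hfg i)

theorem hasSum_phi_pow {q : ℝ} (hq : q ≠ 0) (hq1 : |q| < 1) (k : ℕ) (hk : k ≠ 0) :
    HasSum (fun n : ℤ => q ^ (k * n ^ 2)) (phi (q ^ k)) :=
  (hasSum_phi (pow_ne_zero k hq) (abs_pow_lt_one hq1 hk)).congr_fun fun n => by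
    rw [zpow_mul, zpow_natCast]

theorem hasSum_psi_pow {q : ℝ} (hq : q ≠ 0) (hq1 : |q| < 1) (k : ℕ) (hk : k ≠ 0) :
    HasSum (fun n : ℤ => q ^ (k * (2 * n ^ 2 + n))) (psi (q ^ k)) :=
  (hasSum_psi (pow_ne_zero k hq) (abs_pow_lt_one hq1 hk)).congr_fun fun n => by
    rw [zpow_mul _ (k : ℤ), zpow_natCast]

theorem Int.bijective_even_odd : Function.Bijective fun p : ℤ × Fin 2 => 2 * p.1 + (p.2 : ℤ) := by
  refine ⟨?_, fun n => ⟨(n / 2, ⟨(n % 2).toNat, by omega⟩), by dsimp only; omega⟩⟩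
  rintro ⟨a, i, hi⟩ ⟨b, j, hj⟩ h
  simp only [Prod.mk.injEq, Fin.mk.injEq] at h ⊢
  omega

/-- The pronic form of the theta series `ψ(q²)`. -/
theorem hasSum_pronic {q : ℝ} (hq : q ≠ 0) (hq1 : |q| < 1) (k : ℕ) (hk : k ≠ 0) :
    HasSum (fun n : ℤ => q ^ (k * (n ^ 2 + n))) (2 * psi (q ^ (2 * k))) := by
  have h := hasSum_psi_pow hq hq1 (2 * k) (by omega)
  have h0 := HasSum.of_residues Int.bijective_even_odd (f := fun n : ℤ => q ^ (k * (n ^ 2 + n)))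
    (v := fun _ => psi (q ^ (2 * k))) fun r => by
      fin_cases r
      · refine h.congr_fun fun n => congrArg (q ^ ·) ?_
        simp
        ring
      · rw [← (Equiv.subLeft (-1 : ℤ)).hasSum_iff]
        refine h.congr_fun fun n => congrArg (q ^ ·) ?_
        simp
        ring
  simpa [two_mul] using h0

/-- The dissection `φ(q) = φ(q⁴) + 2 q ψ(q⁸)`. -/
theorem phi_dissection {q : ℝ} (hq : q ≠ 0) (hq1 : |q| < 1) :
    phi q = phi (q ^ 4) + 2 * q * psi (q ^ 8) := by
  have h0 := HasSum.of_residues Int.bijective_even_odd (f := fun n : ℤ => q ^ (n ^ 2))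
    (v := ![phi (q ^ 4), q * (2 * psi (q ^ 8))]) fun r => by
      fin_cases r
      · refine (hasSum_phi_pow hq hq1 4 (by norm_num)).congr_fun fun n => congrArg (q ^ ·) ?_
        simp
        ring
      · have := (hasSum_pronic hq hq1 4 (by norm_num)).zpow_shift hq 1
        rw [zpow_one] at this
        refine this.congr_fun fun n => congrArg (q ^ ·) ?_
        simp
        ring
  rw [(hasSum_phi hq hq1).unique h0]
  simp
  ring

theorem phi_sq_sub_phi_sq {q : ℝ} (hq : q ≠ 0) (hq1 : |q| < 1) :
    (phi q ^ 2 - phi (q ^ 5) ^ 2) * (euler (q ^ 2) * euler (-q ^ 5)) =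
      4 * q * (euler (q ^ 10) ^ 3 * euler (-q)) := by
  obtain ⟨u, v, hu, hv, huv⟩ := exists_hasSum_quintic hq hq1
  have e : Function.Bijective fun p : (ℤ × ℤ) × Fin 5 =>
      (2 * p.1.1 + p.1.2 + (p.2 : ℤ), 2 * p.1.2 - p.1.1) := by
    refine ⟨?_, ?_⟩
    · rintro ⟨⟨a, b⟩, i, hi⟩ ⟨⟨c, d⟩, j, hj⟩ h
      simp only [Prod.mk.injEq, Fin.mk.injEq] at h ⊢
      omega
    · rintro ⟨x, y⟩
      refine ⟨⟨⟨(2 * x - y - 2 * ((x + 2 * y) % 5)) / 5, (x + 2 * y) / 5⟩,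
        ⟨((x + 2 * y) % 5).toNat, by omega⟩⟩, ?_⟩
      simp only [Prod.mk.injEq]
      omega
  have huv' := (hu.zpow_mul hq hv).zpow_shift hq 1
  have hvu' := (hv.zpow_mul hq hu).zpow_shift hq 1
  rw [zpow_one] at huv' hvu'
  rw [mul_comm v] at hvu'
  have h0 := HasSum.of_residues e (f := fun p : ℤ × ℤ => q ^ (p.1 ^ 2 + p.2 ^ 2))
    (v := ![phi (q ^ 5) ^ 2, q * (u * v), q * (u * v), q * (u * v), q * (u * v)]) fun r => by
      fin_cases r
      · have h := hasSum_phi_pow hq hq1 5 (by norm_num)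
        refine (sq (phi (q ^ 5)) ▸ h.zpow_mul hq h).congr_fun fun p => congrArg (q ^ ·) ?_
        simp
        ring
      · refine huv'.congr_fun fun p => congrArg (q ^ ·) ?_
        simp
        ring
      · refine hvu'.zpow_bij ((Equiv.subLeft (-1 : ℤ)).prodCongr (Equiv.refl ℤ)).bijective fun p => ?_
        simp
        ring
      · refine hvu'.zpow_bij
          ((Equiv.subRight (1 : ℤ)).prodCongr (Equiv.subLeft (-1 : ℤ))).bijective fun p => ?_
        simp
        ring
      · refine huv'.zpow_bij
          ((Equiv.subLeft (-2 : ℤ)).prodCongr (Equiv.subLeft (-1 : ℤ))).bijective fun p => ?_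
        simp
        ring
  have h1 := ((hasSum_phi hq hq1).zpow_mul hq (hasSum_phi hq hq1)).unique h0
  simp [Fin.sum_univ_five] at h1
  linear_combination (euler (q ^ 2) * euler (-q ^ 5)) * h1 + 4 * q * huv

theorem summable_zpow_comp {ι κ : Type*} {q : ℝ} {f : ι → ℤ} {a : ℝ}
    (hf : HasSum (fun i => q ^ f i) a) {e : κ → ι} (he : e.Injective) :
    ∃ b, HasSum (fun k => q ^ f (e k)) b :=
  hf.summable.comp_injective (i := e) he

theorem Int.bijective_mod_three (c : ℤ) :
    Function.Bijective fun p : (ℤ × ℤ) × Fin 3 => (3 * p.1.1 + 5 * p.1.2 + c + (p.2 : ℤ), p.1.2) := by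
  refine ⟨?_, ?_⟩
  · rintro ⟨⟨a, b⟩, i, hi⟩ ⟨⟨c, d⟩, j, hj⟩ h
    simp only [Prod.mk.injEq, Fin.mk.injEq] at h ⊢
    omega
  · rintro ⟨x, y⟩
    exact ⟨⟨⟨(x - 5 * y - c) / 3, y⟩, ⟨((x - 5 * y - c) % 3).toNat, by omega⟩⟩,
      Prod.ext (by dsimp only; omega) rfl⟩

/-- The product of two pentagonal series, split by the parity of the difference of the indices. -/
theorem exists_hasSum_pentagonal_mul {q : ℝ} (hq : q ≠ 0) (hq1 : |q| < 1) :
    ∃ a b : ℝ, euler q * euler (q ^ 5) = a - b ∧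
      HasSum (fun p : ℤ × ℤ =>
        q ^ (9 * p.1 ^ 2 + 30 * p.1 * p.2 + 30 * p.2 ^ 2 - 3 * p.1 - 5 * p.2)) a ∧
      HasSum (fun p : ℤ × ℤ =>
        q ^ (9 * p.1 ^ 2 + 30 * p.1 * p.2 + 30 * p.2 ^ 2 + 12 * p.1 + 25 * p.2 + 5)) b := by
  have h := (hasSum_euler hq hq1).mul_real
    (hasSum_euler (pow_ne_zero 5 hq) (abs_pow_lt_one hq1 (k := 5) (by norm_num)))
  have e : Function.Bijective fun p : (ℤ × ℤ) × Fin 2 => (p.1.1, p.1.1 + 2 * p.1.2 + (p.2 : ℤ)) := by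
    refine ⟨?_, ?_⟩
    · rintro ⟨⟨a, b⟩, i, hi⟩ ⟨⟨c, d⟩, j, hj⟩ h
      simp only [Prod.mk.injEq, Fin.mk.injEq] at h ⊢
      omega
    · rintro ⟨x, y⟩
      exact ⟨⟨⟨x, (y - x) / 2⟩, ⟨((y - x) % 2).toNat, by omega⟩⟩,
        Prod.ext rfl (by dsimp only; omega)⟩
  have hi : ∀ r : Fin 2, Function.Injective fun p : ℤ × ℤ => (p.1, p.1 + 2 * p.2 + (r : ℤ)) :=
    fun r => e.1.comp (f := fun p : ℤ × ℤ => (p, r)) fun a b hab => congrArg Prod.fst hab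
  obtain ⟨a, ha⟩ := h.summable.comp_injective (hi 0)
  obtain ⟨b, hb⟩ := h.summable.comp_injective (hi 1)
  refine ⟨a, -b, ?_, ?_, ?_⟩
  · rw [h.unique (HasSum.of_residues e (v := ![a, b]) fun r => by
      fin_cases r
      exacts [ha, hb])]
    simp
  · refine ha.congr_fun fun p => ?_
    have e1 := Int.two_mul_triangle p.1
    have e2 := Int.two_mul_triangle (p.1 + 2 * p.2)
    simp only [Function.comp_apply, Fin.val_zero, Nat.cast_zero, add_zero]
    rw [mul_mul_mul_comm, ← zpow_add₀ (by norm_num), Even.neg_one_zpow ⟨p.1 + p.2, by ring⟩,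
      ← zpow_natCast q 5, ← zpow_mul, ← zpow_add₀ hq, one_mul]
    congr 1
    push_cast
    linarith
  · refine hb.neg.congr_fun fun p => ?_
    have e1 := Int.two_mul_triangle p.1
    have e2 := Int.two_mul_triangle (p.1 + 2 * p.2 + 1)
    simp only [Function.comp_apply, Fin.val_one, Nat.cast_one]
    rw [mul_mul_mul_comm, ← zpow_add₀ (by norm_num), Odd.neg_one_zpow ⟨p.1 + p.2, by ring⟩,
      ← zpow_natCast q 5, ← zpow_mul, ← zpow_add₀ hq, neg_one_mul, neg_neg]
    congr 1
    push_cast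
    linarith

theorem euler_mul_euler {q : ℝ} (hq : q ≠ 0) (hq1 : |q| < 1) :
    psi (q ^ 2) * phi (q ^ 5) - q * phi q * psi (q ^ 10) = euler q * euler (q ^ 5) := by
  obtain ⟨a, b, hab, ha, hb⟩ := exists_hasSum_pentagonal_mul hq hq1
  have h1 := (hasSum_pronic hq hq1 1 one_ne_zero).zpow_mul hq
    (hasSum_phi_pow hq hq1 5 (by norm_num))
  have h2 := ((hasSum_phi hq hq1).zpow_mul hq
    (hasSum_pronic hq hq1 5 (by norm_num))).zpow_shift hq 1
  have b1 := Int.bijective_mod_three (-1)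
  have b2 := Int.bijective_mod_three 2
  have hi : ∀ r : Fin 3, Function.Injective fun p : ℤ × ℤ => (p, r) :=
    fun _ a b hab => congrArg Prod.fst hab
  obtain ⟨z, hz⟩ := summable_zpow_comp h1 (b1.1.comp (hi 2))
  have h3 := h1.unique <| HasSum.of_residues b1 (v := ![a, a, z]) fun r => by
    fin_cases r
    · refine ha.congr_fun fun p => congrArg (q ^ ·) ?_
      simp
      ring
    · refine ha.zpow_bij (Equiv.neg (ℤ × ℤ)).bijective fun p => ?_
      simp
      ring
    · exact hz
  have h4 := h2.unique <| HasSum.of_residues b2 (v := ![b, b, z]) fun r => by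
    fin_cases r
    · refine hb.congr_fun fun p => congrArg (q ^ ·) ?_
      simp
      ring
    · refine hb.zpow_bij ((Equiv.neg ℤ).prodCongr (Equiv.subLeft (-1 : ℤ))).bijective fun p => ?_
      simp
      ring
    · refine hz.zpow_bij (e := fun p : ℤ × ℤ => (p.1, -p.1 - p.2 - 1)) ?_ fun p => ?_
      · exact (Function.Involutive.bijective fun p => Prod.ext rfl (by dsimp only; ring))
      · simp
        ring
  simp [Fin.sum_univ_three] at h3 h4
  rw [hab]
  linear_combination h3 / 2 - h4 / 2

theorem phi_mul_phi_neg_sub {q : ℝ} (hq : q ≠ 0) (hq1 : |q| < 1) :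
    phi q * phi (-q ^ 5) - phi (-q) * phi (q ^ 5) = 4 * q * (euler (q ^ 4) * euler (q ^ 20)) := by
  have hq5 := abs_pow_lt_one hq1 (k := 5) (by norm_num)
  have h1 := phi_dissection hq hq1
  have h2 := phi_dissection (neg_ne_zero.2 hq) (by rwa [abs_neg])
  have h3 := phi_dissection (pow_ne_zero 5 hq) hq5
  have h4 := phi_dissection (q := -q ^ 5) (neg_ne_zero.2 (pow_ne_zero 5 hq)) (by rwa [abs_neg])
  have h5 := euler_mul_euler (pow_ne_zero 4 hq) (abs_pow_lt_one hq1 four_ne_zero)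
  rw [Even.neg_pow (by decide), Even.neg_pow (by decide)] at h2 h4
  simp only [← pow_mul, Nat.reduceMul] at h1 h2 h3 h4 h5
  rw [h1, h2, h3, h4, ← h5]
  ring

theorem phi_cube_sub {q : ℝ} (hq : q ≠ 0) (hq1 : |q| < 1) :
    phi q ^ 3 - 3 * (phi q * phi (q ^ 5) ^ 2) =
      8 * q ^ 2 * (psi q * psi (q ^ 5) * psi (q ^ 10)) -
        2 * (phi (-q ^ 2) * phi (-q ^ 10) * phi (-q ^ 5)) := by
  have hk {k : ℕ} (h : k ≠ 0) := abs_pow_lt_one hq1 h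
  have hn {k : ℕ} : q ^ k ≠ 0 := pow_ne_zero k hq
  have hq1' : |(-q)| < 1 := by rwa [abs_neg]
  have hq5' : |(-q ^ 5)| < 1 := by rw [abs_neg]; exact hk (by norm_num)
  have p1 := euler_pos hq1
  have m1 := euler_pos hq1'
  have m5 := euler_pos hq5'
  have p2 := euler_pos (hk (k := 2) (by norm_num))
  have p4 := euler_pos (hk (k := 4) (by norm_num))
  have p5 := euler_pos (hk (k := 5) (by norm_num))
  have p10 := euler_pos (hk (k := 10) (by norm_num))
  have p20 := euler_pos (hk (k := 20) (by norm_num))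
  have r1 := euler_neg_mul hq1
  have r5 := euler_neg_mul (hk (k := 5) (by norm_num))
  have a := phi_eq hq hq1
  have b := phi_eq hn (hk (k := 5) (by norm_num))
  have b' := phi_neg_eq hn (hk (k := 5) (by norm_num))
  have k := psi_eq hq hq1
  have l := psi_eq hn (hk (k := 5) (by norm_num))
  have h := psi_sq_eq hn (hk (k := 5) (by norm_num))
  have D := phi_neg_eq hn (hk (k := 2) (by norm_num))
  have d := phi_neg_eq hn (hk (k := 10) (by norm_num))
  have L := phi_sq_sub_phi_sq hq hq1
  have T := euler_mul_euler (neg_ne_zero.2 hq) hq1'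
  have T' := euler_mul_euler hq hq1
  have U := phi_mul_phi_neg_sub hq hq1
  rw [Even.neg_pow (by decide), Odd.neg_pow (by decide), Even.neg_pow (by decide)] at T
  simp only [← pow_mul, Nat.reduceMul] at r5 b b' l h D d
  have i1 : (phi q ^ 2 - phi (q ^ 5) ^ 2) * (euler (-q) * euler (-q ^ 5)) =
      4 * q * (phi q * phi (q ^ 5) * phi (-q ^ 5) * psi (q ^ 10)) := by
    have e : phi q * phi (q ^ 5) * phi (-q ^ 5) * psi (q ^ 10) * euler (q ^ 2) =
        euler (q ^ 10) ^ 3 * euler (-q) ^ 2 := by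
      rw [a, b, b', h]
      field_simp
      linear_combination (euler (-q ^ 5) * (euler (q ^ 5) * euler (q ^ 20)) +
        euler (q ^ 10) ^ 3) * r5
    refine mul_right_cancel₀ p2.ne' ?_
    linear_combination euler (-q) * L - 4 * q * e
  have i2 : psi q * psi (q ^ 5) * (euler (-q) * euler (-q ^ 5)) =
      phi q * phi (q ^ 5) * (euler (q ^ 4) * euler (q ^ 20)) := by
    rw [a, b, k, l]
    field_simp
  have i3 : phi (-q ^ 2) * phi (-q ^ 10) * (euler (-q) * euler (-q ^ 5)) =
      phi q * phi (q ^ 5) * (euler q * euler (q ^ 5)) := by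
    rw [a, b, D, d]
    field_simp
    linear_combination (-euler (q ^ 10) ^ 3) * r1 -
      (euler (-q) * (euler q * euler (q ^ 4))) * r5
  refine mul_right_cancel₀ (mul_pos m1 m5).ne' ?_
  linear_combination phi q * i1 - 8 * q ^ 2 * psi (q ^ 10) * i2 + 2 * phi (-q ^ 5) * i3 +
    2 * phi q * phi (q ^ 5) * psi (q ^ 10) * q * U
    + 2 * phi q * phi (q ^ 5) ^ 2 * T - 2 * phi q * phi (q ^ 5) * phi (-q ^ 5) * T'

theorem summable_zpow_of_le {ι : Type*} {q : ℝ} (hq : q ≠ 0) (hq1 : |q| < 1) {f g : ι → ℤ}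
    (hf : Summable fun i => |q| ^ f i) (hfg : ∀ i, f i ≤ g i) : Summable fun i => q ^ g i :=
  Summable.of_norm_bounded hf fun i => by
    rw [Real.norm_eq_abs, abs_zpow]
    exact zpow_le_zpow_right_of_le_one₀ (abs_pos.2 hq) hq1.le (hfg i)

theorem summable_binary {q : ℝ} (hq : q ≠ 0) (hq1 : |q| < 1) :
    Summable fun p : ℤ × ℤ => q ^ (2 * p.1 ^ 2 + 2 * p.1 * p.2 + 3 * p.2 ^ 2) := by
  have h := hasSum_phi (abs_ne_zero.2 hq) (by rwa [abs_abs])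
  refine summable_zpow_of_le hq hq1 (h.zpow_mul (abs_ne_zero.2 hq) h).summable fun p => ?_
  nlinarith [sq_nonneg (p.1 + p.2)]

theorem Int.bijective_shear :
    Function.Bijective fun p : (ℤ × ℤ) × Fin 2 => (p.1.1 - p.1.2, 2 * p.1.2 + (p.2 : ℤ)) := by
  refine ⟨?_, ?_⟩
  · rintro ⟨⟨a, b⟩, i, hi⟩ ⟨⟨c, d⟩, j, hj⟩ h
    simp only [Prod.mk.injEq, Fin.mk.injEq] at h ⊢
    omega
  · rintro ⟨x, y⟩
    exact ⟨⟨⟨x + y / 2, y / 2⟩, ⟨(y % 2).toNat, by omega⟩⟩,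
      Prod.ext (by dsimp only; omega) (by dsimp only; omega)⟩

theorem hasSum_binary_shift {q : ℝ} (hq : q ≠ 0) (hq1 : |q| < 1) :
    HasSum (fun p : ℤ × ℤ =>
      q ^ (2 * p.1 ^ 2 + 2 * p.1 * p.2 + p.1 + 3 * p.2 ^ 2 + 3 * p.2))
      (2 * (psi q * psi (q ^ 5))) := by
  have h := (hasSum_psi hq hq1).zpow_mul hq (hasSum_psi_pow hq hq1 5 (by norm_num))
  rw [show 2 * (psi q * psi (q ^ 5)) = ∑ _r : Fin 2, psi q * psi (q ^ 5) by simp]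
  refine HasSum.of_residues Int.bijective_shear fun r => ?_
  fin_cases r
  · refine h.congr_fun fun p => congrArg (q ^ ·) ?_
    simp
    ring
  · refine h.zpow_bij ((Equiv.subLeft (-1 : ℤ)).prodCongr (Equiv.subLeft (-1 : ℤ))).bijective
      fun p => ?_
    simp
    ring

theorem Int.neg_one_zpow_congr {m n : ℤ} (h : Even (m - n)) : (-1 : ℝ) ^ m = (-1) ^ n := by
  rw [← sub_add_cancel m n, zpow_add₀ (by norm_num), h.neg_one_zpow, one_mul]

theorem hasSum_phi_neg_pow {q : ℝ} (hq : q ≠ 0) (hq1 : |q| < 1) (k : ℕ) (hk : k ≠ 0) :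
    HasSum (fun n : ℤ => (-1) ^ n * q ^ (k * n ^ 2)) (phi (-q ^ k)) :=
  (hasSum_phi (neg_ne_zero.2 (pow_ne_zero k hq)) (by
    rw [abs_neg]; exact abs_pow_lt_one hq1 hk)).congr_fun fun n => by
    rw [zpow_mul, zpow_natCast, neg_eq_neg_one_mul (q ^ k), mul_zpow,
      Int.neg_one_zpow_congr (m := n ^ 2) (n := n)]
    rw [sq, ← mul_sub_one]
    exact Int.even_mul_pred_self n

theorem hasSum_binary_signed {q : ℝ} (hq : q ≠ 0) (hq1 : |q| < 1) :
    HasSum (fun p : ℤ × ℤ =>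
      (-1) ^ (p.1 + p.2) * q ^ (2 * p.1 ^ 2 + 2 * p.1 * p.2 + 3 * p.2 ^ 2))
      (phi (-q ^ 2) * phi (-q ^ 10)) := by
  have h := (hasSum_phi_neg_pow hq hq1 2 (by norm_num)).mul_real
    (hasSum_phi_neg_pow hq hq1 10 (by norm_num))
  have hs : Summable fun p : ℤ × ℤ =>
      (-1) ^ (p.1 + p.2) * q ^ (2 * p.1 ^ 2 + 2 * p.1 * p.2 + 3 * p.2 ^ 2) :=
    Summable.of_norm ((summable_binary hq hq1).norm.congr fun p => by simp)
  obtain ⟨z, hz⟩ := hs.comp_injective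
    (Int.bijective_shear.1.comp (f := fun p : ℤ × ℤ => (p, 1)) fun a b hab => congrArg Prod.fst hab)
  have hz' := ((Equiv.subLeft (-1 : ℤ)).prodCongr (Equiv.refl ℤ)).hasSum_iff.2 hz
  have hz0 : z = -z := hz'.unique <| hz.neg.congr_fun fun p => by
    simp only [Function.comp_apply, Fin.val_one, Nat.cast_one, Equiv.prodCongr_apply,
      Equiv.subLeft_apply, Equiv.coe_refl, Prod.map_fst, Prod.map_snd, id_eq]
    rw [Int.neg_one_zpow_congr (n := p.1 - p.2 + (2 * p.2 + 1) + 1) ⟨-p.1 - 1, by ring⟩,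
      zpow_add_one₀ (by norm_num), mul_neg_one, neg_mul]
    congr 3
    ring
  have hz1 : z = 0 := by linarith
  subst hz1
  rw [show phi (-q ^ 2) * phi (-q ^ 10) = ∑ r, ![phi (-q ^ 2) * phi (-q ^ 10), 0] r by simp]
  refine HasSum.of_residues Int.bijective_shear fun r => ?_
  fin_cases r
  · refine h.congr_fun fun p => ?_
    simp only [Nat.cast_zero, add_zero]
    rw [mul_mul_mul_comm ((-1) ^ _), ← zpow_add₀ (by norm_num : (-1 : ℝ) ≠ 0), ← zpow_add₀ hq]
    congr 2
    · ring
    · push_cast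
      ring
  · exact hz

theorem hasSum_form_two {q : ℝ} (hq : q ≠ 0) (hq1 : |q| < 1) {a : ℝ}
    (ha : HasSum (fun p : ℤ × ℤ => q ^ (2 * p.1 ^ 2 + 2 * p.1 * p.2 + 3 * p.2 ^ 2)) a) :
    HasSum (fun v : ℤ × ℤ × ℤ =>
      q ^ (2 * v.1 ^ 2 + 2 * v.2.1 ^ 2 + 2 * v.2.2 ^ 2 + -1 * v.2.1 * v.2.2 +
        1 * v.2.2 * v.1 + 1 * v.1 * v.2.1))
      (a * phi (q ^ 5) + 4 * q ^ 2 * (psi q * psi (q ^ 5) * psi (q ^ 10))) := by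
  have h0 := ha.zpow_mul hq (hasSum_phi_pow hq hq1 5 (by norm_num))
  have h1 := ((hasSum_binary_shift hq hq1).zpow_mul hq
    (hasSum_pronic hq hq1 5 (by norm_num))).zpow_shift hq 2
  have e : Function.Bijective fun p : ((ℤ × ℤ) × ℤ) × Fin 2 =>
      (p.1.1.1, p.1.1.2 + p.1.2 + (p.2 : ℤ), p.1.1.2 - p.1.2) := by
    refine ⟨?_, ?_⟩
    · rintro ⟨⟨⟨a, b⟩, c⟩, i, hi⟩ ⟨⟨⟨a', b'⟩, c'⟩, j, hj⟩ h
      simp only [Prod.mk.injEq, Fin.mk.injEq] at h ⊢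
      omega
    · rintro ⟨x, y, z⟩
      exact ⟨⟨⟨⟨x, (y + z) / 2⟩, (y - z) / 2⟩, ⟨((y + z) % 2).toNat, by omega⟩⟩,
        Prod.ext rfl (Prod.ext (by dsimp only; omega) (by dsimp only; omega))⟩
  have h2 : a * phi (q ^ 5) + 4 * q ^ 2 * (psi q * psi (q ^ 5) * psi (q ^ 10)) =
      ∑ r, ![a * phi (q ^ 5),
        q ^ (2 : ℤ) * (2 * (psi q * psi (q ^ 5)) * (2 * psi (q ^ (2 * 5))))] r := by
    simp
    norm_cast
    ring
  rw [h2]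
  refine HasSum.of_residues e fun r => ?_
  fin_cases r
  · refine h0.congr_fun fun p => congrArg (q ^ ·) ?_
    simp
    ring
  · refine h1.congr_fun fun p => congrArg (q ^ ·) ?_
    simp
    ring

theorem hasSum_form_seven {q : ℝ} (hq : q ≠ 0) (hq1 : |q| < 1) {a : ℝ}
    (ha : HasSum (fun p : ℤ × ℤ => q ^ (2 * p.1 ^ 2 + 2 * p.1 * p.2 + 3 * p.2 ^ 2)) a) :
    HasSum (fun v : ℤ × ℤ × ℤ =>
      q ^ (7 * v.1 ^ 2 + 8 * v.2.1 ^ 2 + 8 * v.2.2 ^ 2 + -4 * v.2.1 * v.2.2 +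
        8 * v.2.2 * v.1 + 8 * v.1 * v.2.1))
      ((a * phi (q ^ 5) + phi (-q ^ 2) * phi (-q ^ 10) * phi (-q ^ 5)) / 2) := by
  have h0 := ha.mul_real (hasSum_phi_pow hq hq1 5 (by norm_num))
  have h1 := (hasSum_binary_signed hq hq1).mul_real (hasSum_phi_neg_pow hq hq1 5 (by norm_num))
  have hi : Function.Injective fun v : ℤ × ℤ × ℤ =>
      ((v.1, v.1 + v.2.1 + v.2.2), v.2.1 - v.2.2) := by
    rintro ⟨a, b, c⟩ ⟨a', b', c'⟩ h
    simp only [Prod.mk.injEq] at h ⊢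
    omega
  refine (((hi.hasSum_iff ?_).2 (h0.add h1)).div_const 2).congr_fun fun v => ?_
  · rintro ⟨⟨x, v⟩, u⟩ hx
    have ho : Odd (x + v + u) := by
      rw [← Int.not_even_iff_odd]
      rintro ⟨k, hk⟩
      exact hx ⟨(x, k - x, v - k),
        Prod.ext (Prod.ext rfl (by dsimp only; omega)) (by dsimp only; omega)⟩
    dsimp only
    rw [mul_mul_mul_comm, ← zpow_add₀ (by norm_num : (-1 : ℝ) ≠ 0), ho.neg_one_zpow]
    ring
  · simp only [Function.comp_apply]
    rw [mul_mul_mul_comm ((-1) ^ _), ← zpow_add₀ (by norm_num : (-1 : ℝ) ≠ 0),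
      Even.neg_one_zpow ⟨v.1 + v.2.1, by ring⟩, ← zpow_add₀ hq, one_mul, add_self_div_two]
    congr 1
    push_cast
    ring

theorem hasSum_ncard {ι : Type*} {q : ℝ} {Q : ι → ℤ} (hQ : ∀ v, 0 ≤ Q v) {a : ℝ}
    (h : HasSum (fun v => q ^ Q v) a) :
    HasSum (fun n : ℕ => (Set.ncard {v | Q v = n} : ℝ) * q ^ n) a := by
  refine (h.tsum_fiberwise fun v => (Q v).toNat).congr_fun fun n => ?_
  have hs : {v | Q v = n} = (fun v => (Q v).toNat) ⁻¹' {n} := by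
    ext v
    have := hQ v
    simp only [Set.mem_ofPred_eq, Set.mem_preimage, Set.mem_singleton_iff]
    omega
  rw [← hs, tsum_congr fun v : {v | Q v = n} => show q ^ Q v = q ^ n by
    rw [v.2, zpow_natCast], tsum_const, nsmul_eq_mul, Nat.card_coe_set_eq]

theorem eq_zero_of_hasSum_pow_zero {c : ℕ → ℝ}
    (h : ∀ q : ℝ, q ≠ 0 → |q| < 1 → HasSum (fun n => c n * q ^ n) 0) (n : ℕ) : c n = 0 := by
  induction n using Nat.strong_induction_on with
  | _ N ih =>
    have h1 : ∀ q : ℝ, q ≠ 0 → |q| < 1 → HasSum (fun n => c (n + N) * q ^ n) 0 := by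
      intro q hq hq1
      have h2 := (hasSum_nat_add_iff' N).2 (h q hq hq1)
      rw [Finset.sum_eq_zero fun i hi => by rw [ih i (Finset.mem_range.1 hi), zero_mul]] at h2
      have h3 := h2.div_const (q ^ N)
      rw [sub_zero, zero_div] at h3
      refine h3.congr_fun fun n => ?_
      rw [pow_add]
      field_simp
    have hb := (h1 (1 / 2) (by norm_num) (by rw [abs_of_pos] <;> norm_num)).summable.norm
    have ht : Tendsto (fun q : ℝ => ∑' n, c (n + N) * q ^ n) (𝓝[≠] 0)
        (𝓝 (∑' n, c (n + N) * 0 ^ n)) := by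
      refine tendsto_tsum_of_dominated_convergence hb (fun n => ?_) ?_
      · exact ((continuous_const.mul (continuous_pow n)).tendsto 0).mono_left nhdsWithin_le_nhds
      · have hd : ∀ᶠ q : ℝ in 𝓝[≠] 0, |q| < 1 / 2 := by
          refine nhdsWithin_le_nhds ?_
          exact continuous_abs.continuousAt.eventually_lt continuousAt_const (by simp)
        filter_upwards [hd] with q hq n
        rw [norm_mul, norm_mul, norm_pow, norm_pow, Real.norm_eq_abs q]
        gcongr
        exact hq.le.trans (le_abs_self _)
    have h0 : ∀ᶠ q : ℝ in 𝓝[≠] 0, ∑' n, c (n + N) * q ^ n = 0 := by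
      have hd : ∀ᶠ q : ℝ in 𝓝[≠] 0, |q| < 1 := by
        refine nhdsWithin_le_nhds ?_
        exact continuous_abs.continuousAt.eventually_lt continuousAt_const (by simp)
      filter_upwards [hd, self_mem_nhdsWithin] with q hq1 hq
      exact (h1 q hq hq1).tsum_eq
    have h4 := tendsto_nhds_unique (ht.congr' h0) tendsto_const_nhds
    rw [tsum_eq_single 0 fun n hn => by rw [zero_pow hn, mul_zero]] at h4
    simpa using h4

theorem s_sub_three_mul (n : ℕ) :
    (s n : ℤ) - 3 * R 1 5 5 0 0 0 n = 2 * R 2 2 2 (-1) 1 1 n - 4 * R 7 8 8 (-4) 8 8 n := by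
  have key := eq_zero_of_hasSum_pow_zero (c := fun n => (s n : ℝ) - 3 * R 1 5 5 0 0 0 n -
      (2 * R 2 2 2 (-1) 1 1 n - 4 * R 7 8 8 (-4) 8 8 n)) (fun q hq hq1 => ?_) n
  · have : (s n : ℝ) - 3 * R 1 5 5 0 0 0 n = 2 * R 2 2 2 (-1) 1 1 n - 4 * R 7 8 8 (-4) 8 8 n := by
      linarith
    exact_mod_cast this
  · obtain ⟨a, ha⟩ := summable_binary hq hq1
    have f := hasSum_phi hq hq1
    have f5 := hasSum_phi_pow hq hq1 5 (by norm_num)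
    have hs := hasSum_ncard (fun v => by positivity) (f.zpow_mul hq (f.zpow_mul hq f))
    have ht := hasSum_ncard (fun v => by positivity) (f.zpow_mul hq (f5.zpow_mul hq f5))
    have hA := hasSum_ncard (fun v => by
      nlinarith [sq_nonneg (v.1 + v.2.1), sq_nonneg (v.1 + v.2.2), sq_nonneg (v.2.1 - v.2.2),
        sq_nonneg v.1, sq_nonneg v.2.1, sq_nonneg v.2.2]) (hasSum_form_two hq hq1 ha)
    have hB := hasSum_ncard (fun v => by
      nlinarith [sq_nonneg (v.1 + v.2.1 + v.2.2), sq_nonneg (v.2.1 - v.2.2), sq_nonneg v.1,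
        sq_nonneg (2 * v.1 + v.2.1 + v.2.2)]) (hasSum_form_seven hq hq1 ha)
    have h := (hs.sub (ht.mul_left 3)).sub ((hA.mul_left 2).sub (hB.mul_left 4))
    have hz : phi q * (phi q * phi q) - 3 * (phi q * (phi (q ^ 5) * phi (q ^ 5))) -
        (2 * (a * phi (q ^ 5) + 4 * q ^ 2 * (psi q * psi (q ^ 5) * psi (q ^ 10))) -
          4 * ((a * phi (q ^ 5) + phi (-q ^ 2) * phi (-q ^ 10) * phi (-q ^ 5)) / 2)) = 0 := by
      linear_combination phi_cube_sub hq hq1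
    rw [hz] at h
    refine h.congr_fun fun n => ?_
    have e1 : s n = Set.ncard {v : ℤ × ℤ × ℤ | v.1 ^ 2 + (v.2.1 ^ 2 + v.2.2 ^ 2) = n} := by
      simp only [s, add_assoc]
    have e2 : R 1 5 5 0 0 0 n = Set.ncard {v : ℤ × ℤ × ℤ |
        v.1 ^ 2 + (((5 : ℕ) : ℤ) * v.2.1 ^ 2 + ((5 : ℕ) : ℤ) * v.2.2 ^ 2) = n} := by
      simp [R, add_assoc]
    rw [e1, e2, R, R]
    ring

theorem Set.ncard_eq_of_forall_mem_iff {α β : Type*} {S : Set α} {T : Set β} {f : α → β}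
    (hf : f.Injective) (h : ∀ b, b ∈ T ↔ ∃ a ∈ S, f a = b) : T.ncard = S.ncard := by
  rw [← Set.ncard_image_of_injective S hf]
  congr 1
  ext b
  exact h b

theorem finite_ternary {c : ℤ} (hc : 1 ≤ c) (m : ℤ) :
    {v : ℤ × ℤ × ℤ | v.1 ^ 2 + v.2.1 ^ 2 + c * v.2.2 ^ 2 = m}.Finite := by
  refine ((Set.finite_Icc (-m) m).prod ((Set.finite_Icc (-m) m).prod
    (Set.finite_Icc (-m) m))).subset ?_
  rintro ⟨x, y, z⟩ h
  simp only [Set.mem_ofPred_eq] at h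
  have ha : ∀ a : ℤ, |a| ≤ a ^ 2 := fun a => by
    rw [Int.abs_eq_natAbs]
    exact Int.natAbs_le_self_sq a
  have hx := ha x
  have hy := ha y
  have hz := ha z
  have hz' : z ^ 2 ≤ c * z ^ 2 := le_mul_of_one_le_left (sq_nonneg z) hc
  have := sq_nonneg x
  have := sq_nonneg y
  have := sq_nonneg z
  simp only [Set.mem_prod, Set.mem_Icc, ← abs_le]
  refine ⟨?_, ?_, ?_⟩ <;> linarith

theorem Int.five_dvd_of_sq_add_sq {x y : ℤ} (h : 5 ∣ x ^ 2 + y ^ 2) :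
    5 ∣ x - 2 * y ∨ 5 ∣ x + 2 * y :=
  (Int.prime_ofNat_iff.2 Nat.prime_five).dvd_or_dvd (by
    rw [show (x - 2 * y) * (x + 2 * y) = x ^ 2 + y ^ 2 - 5 * y ^ 2 by ring]
    exact dvd_sub h (dvd_mul_right _ _))

/-- Multiplication by the Gaussian integer `2 + i`, or by its conjugate, on the first two
coordinates. -/
theorem ncard_ternary_split {c m : ℤ} (hc : 1 ≤ c) {P : ℤ → Prop}
    (hP : ∀ z, P z → 5 ∣ m - c * z ^ 2) :
    {v : ℤ × ℤ × ℤ | v.1 ^ 2 + v.2.1 ^ 2 + c * v.2.2 ^ 2 = m ∧ P v.2.2}.ncard +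
      {v : ℤ × ℤ × ℤ | (v.1 ^ 2 + v.2.1 ^ 2 + c * v.2.2 ^ 2 = m ∧ P v.2.2) ∧
        5 ∣ v.1 ∧ 5 ∣ v.2.1}.ncard =
      2 * {v : ℤ × ℤ × ℤ | 5 * v.1 ^ 2 + 5 * v.2.1 ^ 2 + c * v.2.2 ^ 2 = m ∧ P v.2.2}.ncard := by
  set A := {v : ℤ × ℤ × ℤ | v.1 ^ 2 + v.2.1 ^ 2 + c * v.2.2 ^ 2 = m ∧ P v.2.2} with hA
  set E := {v : ℤ × ℤ × ℤ | 5 * v.1 ^ 2 + 5 * v.2.1 ^ 2 + c * v.2.2 ^ 2 = m ∧ P v.2.2} with hE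
  have hfin : ∀ B : Set (ℤ × ℤ × ℤ), {v | v ∈ A ∧ v ∈ B}.Finite := fun B =>
    (finite_ternary hc m).subset fun v hv => hv.1.1
  have h1 : {v | v ∈ A ∧ v ∈ {v : ℤ × ℤ × ℤ | 5 ∣ v.1 - 2 * v.2.1}}.ncard = E.ncard := by
    refine Set.ncard_eq_of_forall_mem_iff
      (f := fun v : ℤ × ℤ × ℤ => (2 * v.1 - v.2.1, v.1 + 2 * v.2.1, v.2.2)) ?_ ?_
    · rintro ⟨a, b, c⟩ ⟨a', b', c'⟩ h
      simp only [Prod.mk.injEq] at h ⊢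
      omega
    · rintro ⟨x, y, z⟩
      simp only [hA, hE, Set.mem_ofPred_eq]
      constructor
      · rintro ⟨⟨h, hz⟩, k, hk⟩
        obtain rfl : x = 2 * y + 5 * k := by linarith
        exact ⟨(y + 2 * k, -k, z), ⟨by linarith, hz⟩,
          Prod.ext (by dsimp only; ring) (Prod.ext (by dsimp only; ring) rfl)⟩
      · rintro ⟨⟨a, b, d⟩, ⟨h, hz⟩, he⟩
        simp only [Prod.mk.injEq] at he h hz
        obtain ⟨rfl, rfl, rfl⟩ := he
        exact ⟨⟨by linarith, hz⟩, -b, by ring⟩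
  have h2 : {v | v ∈ A ∧ v ∈ {v : ℤ × ℤ × ℤ | 5 ∣ v.1 + 2 * v.2.1}}.ncard = E.ncard := by
    refine Set.ncard_eq_of_forall_mem_iff
      (f := fun v : ℤ × ℤ × ℤ => (2 * v.1 - v.2.1, -(v.1 + 2 * v.2.1), v.2.2)) ?_ ?_
    · rintro ⟨a, b, c⟩ ⟨a', b', c'⟩ h
      simp only [Prod.mk.injEq] at h ⊢
      omega
    · rintro ⟨x, y, z⟩
      simp only [hA, hE, Set.mem_ofPred_eq]
      constructor
      · rintro ⟨⟨h, hz⟩, k, hk⟩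
        obtain rfl : x = 5 * k - 2 * y := by linarith
        exact ⟨(2 * k - y, -k, z), ⟨by linarith, hz⟩,
          Prod.ext (by dsimp only; ring) (Prod.ext (by dsimp only; ring) rfl)⟩
      · rintro ⟨⟨a, b, d⟩, ⟨h, hz⟩, he⟩
        simp only [Prod.mk.injEq] at he h hz
        obtain ⟨rfl, rfl, rfl⟩ := he
        exact ⟨⟨by linarith, hz⟩, -b, by ring⟩
  have h3 := Set.ncard_union_add_ncard_inter _ _
    (hfin {v : ℤ × ℤ × ℤ | 5 ∣ v.1 - 2 * v.2.1}) (hfin {v : ℤ × ℤ × ℤ | 5 ∣ v.1 + 2 * v.2.1})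
  rw [h1, h2, ← two_mul] at h3
  rw [← h3]
  congr 2
  · ext v
    simp only [Set.mem_union, Set.mem_ofPred_eq, ← and_or_left, iff_self_and]
    rintro ⟨h, hz⟩
    refine Int.five_dvd_of_sq_add_sq ?_
    rw [eq_sub_of_add_eq h]
    exact hP _ hz
  · ext v
    simp only [Set.mem_inter_iff, Set.mem_ofPred_eq, ← and_and_left]
    refine and_congr_right fun _ => ?_
    omega

theorem Int.five_dvd_of_sq_add_sq_add_sq {x y z : ℤ} (h : 5 ∣ x ^ 2 + y ^ 2 + z ^ 2) :
    5 ∣ x ∨ 5 ∣ y ∨ 5 ∣ z := by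
  have key : ∀ x y z : ZMod 5, x ^ 2 + y ^ 2 + z ^ 2 = 0 → x = 0 ∨ y = 0 ∨ z = 0 := by decide
  have hd : ∀ a : ℤ, 5 ∣ a ↔ (a : ZMod 5) = 0 := fun a =>
    (ZMod.intCast_zmod_eq_zero_iff_dvd a 5).symm
  simp only [hd] at h ⊢
  push_cast at h
  exact key _ _ _ h

theorem Int.five_dvd_right_of_sq_add_sq_add_sq {x y z : ℤ} (h : 5 ∣ x ^ 2 + y ^ 2 + z ^ 2)
    (hx : 5 ∣ x) (hy : 5 ∣ y) : 5 ∣ z := by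
  have h2 : 5 ∣ x ^ 2 + y ^ 2 := dvd_add (dvd_pow hx two_ne_zero) (dvd_pow hy two_ne_zero)
  exact (Int.prime_ofNat_iff.2 Nat.prime_five).dvd_of_dvd_pow ((dvd_add_right h2).1 h)

theorem ncard_all_dvd (n : ℕ) :
    {v : ℤ × ℤ × ℤ | (v.1 ^ 2 + v.2.1 ^ 2 + 1 * v.2.2 ^ 2 = 25 * n ∧ 5 ∣ v.2.2) ∧
      5 ∣ v.1 ∧ 5 ∣ v.2.1}.ncard = s n := by
  refine Set.ncard_eq_of_forall_mem_iff
    (f := fun v : ℤ × ℤ × ℤ => (5 * v.1, 5 * v.2.1, 5 * v.2.2)) ?_ ?_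
  · rintro ⟨a, b, c⟩ ⟨a', b', c'⟩ h
    simp only [Prod.mk.injEq] at h ⊢
    omega
  · rintro ⟨x, y, z⟩
    simp only [Set.mem_ofPred_eq]
    constructor
    · rintro ⟨⟨h, k, rfl⟩, ⟨i, rfl⟩, j, rfl⟩
      exact ⟨(i, j, k), by linarith, rfl⟩
    · rintro ⟨⟨a, b, d⟩, h, he⟩
      simp only [Prod.mk.injEq] at he h
      obtain ⟨rfl, rfl, rfl⟩ := he
      exact ⟨⟨by linarith, dvd_mul_right _ _⟩, dvd_mul_right _ _, dvd_mul_right _ _⟩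

theorem ncard_third_dvd (n : ℕ) :
    {v : ℤ × ℤ × ℤ | v.1 ^ 2 + v.2.1 ^ 2 + 1 * v.2.2 ^ 2 = 25 * n ∧ 5 ∣ v.2.2}.ncard +
      2 * R 1 5 5 0 0 0 n = 3 * s n := by
  have h1 := ncard_ternary_split (c := 1) (m := 25 * n) le_rfl (P := fun z => 5 ∣ z) (by
    rintro z ⟨k, rfl⟩
    exact ⟨5 * n - 5 * k ^ 2, by ring⟩)
  have h2 := ncard_ternary_split (c := 5) (m := 5 * n) (by norm_num) (P := fun _ => True)
    fun z _ => ⟨n - z ^ 2, by ring⟩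
  have e2 : {v : ℤ × ℤ × ℤ | 5 * v.1 ^ 2 + 5 * v.2.1 ^ 2 + 1 * v.2.2 ^ 2 = 25 * n ∧
      5 ∣ v.2.2}.ncard =
      {v : ℤ × ℤ × ℤ | v.1 ^ 2 + v.2.1 ^ 2 + 5 * v.2.2 ^ 2 = 5 * n ∧ True}.ncard := by
    refine Set.ncard_eq_of_forall_mem_iff
      (f := fun v : ℤ × ℤ × ℤ => (v.1, v.2.1, 5 * v.2.2)) ?_ ?_
    · rintro ⟨a, b, c⟩ ⟨a', b', c'⟩ h
      simp only [Prod.mk.injEq] at h ⊢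
      omega
    · rintro ⟨x, y, z⟩
      simp only [Set.mem_ofPred_eq]
      constructor
      · rintro ⟨h, k, rfl⟩
        exact ⟨(x, y, k), ⟨by linarith, trivial⟩, rfl⟩
      · rintro ⟨⟨a, b, d⟩, ⟨h, -⟩, he⟩
        simp only [Prod.mk.injEq] at he h
        obtain ⟨rfl, rfl, rfl⟩ := he
        exact ⟨by linarith, dvd_mul_right _ _⟩
  have e3 : {v : ℤ × ℤ × ℤ | (v.1 ^ 2 + v.2.1 ^ 2 + 5 * v.2.2 ^ 2 = 5 * n ∧ True) ∧
      5 ∣ v.1 ∧ 5 ∣ v.2.1}.ncard = R 1 5 5 0 0 0 n := by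
    refine Set.ncard_eq_of_forall_mem_iff
      (f := fun v : ℤ × ℤ × ℤ => (5 * v.2.1, 5 * v.2.2, v.1)) ?_ ?_
    · rintro ⟨a, b, c⟩ ⟨a', b', c'⟩ h
      simp only [Prod.mk.injEq] at h ⊢
      omega
    · rintro ⟨x, y, z⟩
      simp only [Set.mem_ofPred_eq]
      constructor
      · rintro ⟨⟨h, -⟩, ⟨i, rfl⟩, j, rfl⟩
        exact ⟨(z, i, j), by linarith, rfl⟩
      · rintro ⟨⟨a, b, d⟩, h, he⟩
        simp only [Prod.mk.injEq] at he h
        obtain ⟨rfl, rfl, rfl⟩ := he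
        exact ⟨⟨by linarith, trivial⟩, dvd_mul_right _ _, dvd_mul_right _ _⟩
  have e4 : {v : ℤ × ℤ × ℤ | 5 * v.1 ^ 2 + 5 * v.2.1 ^ 2 + 5 * v.2.2 ^ 2 = 5 * n ∧
      True}.ncard = s n := by
    rw [s]
    congr 1
    ext v
    simp only [Set.mem_ofPred_eq, and_true]
    constructor <;> intro h <;> linarith
  rw [ncard_all_dvd, e2] at h1
  rw [e3, e4] at h2
  omega

theorem s_twentyfive_mul (n : ℕ) : s (25 * n) + 6 * R 1 5 5 0 0 0 n = 7 * s n := by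
  set S := {v : ℤ × ℤ × ℤ | v.1 ^ 2 + v.2.1 ^ 2 + 1 * v.2.2 ^ 2 = 25 * n} with hS
  have hfin : ∀ P : ℤ × ℤ × ℤ → Prop, {v | v ∈ S ∧ P v}.Finite := fun P =>
    (finite_ternary le_rfl _).subset fun v hv => hv.1
  have hd : ∀ v ∈ S, (5 : ℤ) ∣ v.1 ^ 2 + v.2.1 ^ 2 + v.2.2 ^ 2 := fun v hv =>
    ⟨5 * n, by simp only [hS, Set.mem_ofPred_eq] at hv; linarith⟩
  have hz := ncard_third_dvd n
  have hx : {v | v ∈ S ∧ 5 ∣ v.1}.ncard = {v | v ∈ S ∧ 5 ∣ v.2.2}.ncard := by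
    refine Set.ncard_eq_of_forall_mem_iff
      (f := fun v : ℤ × ℤ × ℤ => (v.2.2, v.2.1, v.1)) ?_ ?_
    · rintro ⟨a, b, c⟩ ⟨a', b', c'⟩ h
      simp only [Prod.mk.injEq] at h ⊢
      omega
    · rintro ⟨x, y, z⟩
      simp only [hS, Set.mem_ofPred_eq]
      constructor
      · rintro ⟨h, hx⟩
        exact ⟨(z, y, x), ⟨by linarith, hx⟩, rfl⟩
      · rintro ⟨⟨a, b, d⟩, ⟨h, hx⟩, he⟩
        simp only [Prod.mk.injEq] at he h hx
        obtain ⟨rfl, rfl, rfl⟩ := he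
        exact ⟨by linarith, hx⟩
  have hy : {v | v ∈ S ∧ 5 ∣ v.2.1}.ncard = {v | v ∈ S ∧ 5 ∣ v.2.2}.ncard := by
    refine Set.ncard_eq_of_forall_mem_iff
      (f := fun v : ℤ × ℤ × ℤ => (v.1, v.2.2, v.2.1)) ?_ ?_
    · rintro ⟨a, b, c⟩ ⟨a', b', c'⟩ h
      simp only [Prod.mk.injEq] at h ⊢
      omega
    · rintro ⟨x, y, z⟩
      simp only [hS, Set.mem_ofPred_eq]
      constructor
      · rintro ⟨h, hx⟩
        exact ⟨(x, z, y), ⟨by linarith, hx⟩, rfl⟩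
      · rintro ⟨⟨a, b, d⟩, ⟨h, hx⟩, he⟩
        simp only [Prod.mk.injEq] at he h hx
        obtain ⟨rfl, rfl, rfl⟩ := he
        exact ⟨by linarith, hx⟩
  have hxy := Set.ncard_union_add_ncard_inter _ _ (hfin fun v => 5 ∣ v.1) (hfin fun v => 5 ∣ v.2.1)
  have hxyz := Set.ncard_union_add_ncard_inter _ _ (hfin fun v => 5 ∣ v.1 ∨ 5 ∣ v.2.1)
    (hfin fun v => 5 ∣ v.2.2)
  have o := ncard_all_dvd n
  have o1 : {v | v ∈ S ∧ 5 ∣ v.1} ∩ {v | v ∈ S ∧ 5 ∣ v.2.1} =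
      {v | (v ∈ S ∧ 5 ∣ v.2.2) ∧ 5 ∣ v.1 ∧ 5 ∣ v.2.1} := by
    ext v
    simp only [Set.mem_inter_iff, Set.mem_ofPred_eq]
    have := fun hv => Int.five_dvd_right_of_sq_add_sq_add_sq (hd v hv)
    tauto
  have o2 : {v | v ∈ S ∧ (5 ∣ v.1 ∨ 5 ∣ v.2.1)} ∩ {v | v ∈ S ∧ 5 ∣ v.2.2} =
      {v | (v ∈ S ∧ 5 ∣ v.2.2) ∧ 5 ∣ v.1 ∧ 5 ∣ v.2.1} := by
    ext ⟨x, y, z⟩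
    simp only [Set.mem_inter_iff, Set.mem_ofPred_eq]
    have h1 := fun hv : (x, y, z) ∈ S =>
      Int.five_dvd_right_of_sq_add_sq_add_sq (x := x) (y := z) (z := y)
        (by have := hd _ hv; rwa [add_right_comm] at this)
    have h2 := fun hv : (x, y, z) ∈ S =>
      Int.five_dvd_right_of_sq_add_sq_add_sq (x := y) (y := z) (z := x)
        (by have := hd _ hv; rwa [add_assoc, add_comm] at this)
    tauto
  have u1 : {v | v ∈ S ∧ 5 ∣ v.1} ∪ {v | v ∈ S ∧ 5 ∣ v.2.1} =
      {v | v ∈ S ∧ (5 ∣ v.1 ∨ 5 ∣ v.2.1)} := by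
    ext v
    simp only [Set.mem_union, Set.mem_ofPred_eq, ← and_or_left]
  have u2 : {v | v ∈ S ∧ (5 ∣ v.1 ∨ 5 ∣ v.2.1)} ∪ {v | v ∈ S ∧ 5 ∣ v.2.2} = S := by
    ext v
    simp only [Set.mem_union, Set.mem_ofPred_eq, ← and_or_left, and_iff_left_iff_imp, or_assoc]
    exact fun hv => Int.five_dvd_of_sq_add_sq_add_sq (hd v hv)
  have hs : s (25 * n) = S.ncard := by
    simp [s, hS]
  rw [o1, u1, hx, hy] at hxy
  rw [o2, u2] at hxyz
  change {v | (v ∈ S ∧ 5 ∣ v.2.2) ∧ 5 ∣ v.1 ∧ 5 ∣ v.2.1}.ncard = s n at o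
  change {v | v ∈ S ∧ 5 ∣ v.2.2}.ncard + _ = _ at hz
  omega

theorem sum_three_squares_twentyfive (n : ℕ) :
    (s (25 * n) : ℤ) - 5 * (s n : ℤ) =
      4 * (R 2 2 2 (-1) 1 1 n : ℤ) - 8 * (R 7 8 8 (-4) 8 8 n : ℤ) := by
  have h1 := s_twentyfive_mul n
  have h2 := s_sub_three_mul n
  omega
end
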